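/- For every z in the upper half-plane ℍ, Φ₁₂(x(z)) = Δ(z), where x(z) = (x₁(z),...,x₆(z)) is the vector of eta-multiplied theta constants of order 13 and Δ(z) = η(z)²⁴ is the modular discriminant. -/

import Mathlib

noncomputable section

open Complex

def ζ : ℂ := Complex.exp (2 * Real.pi * Complex.I / 13)

def AA0 (v : Fin 6 → ℂ) : ℂ := v 0 * v 3 + v 1 * v 4 + v 2 * v 5
def AA1 (v : Fin 6 → ℂ) : ℂ := (v 0) ^ 2 - 2 * v 2 * v 3
def AA2 (v : Fin 6 → ℂ) : ℂ := -(v 4) ^ 2 - 2 * v 1 * v 3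
def AA3 (v : Fin 6 → ℂ) : ℂ := (v 1) ^ 2 - 2 * v 0 * v 4
def AA4 (v : Fin 6 → ℂ) : ℂ := (v 2) ^ 2 - 2 * v 1 * v 5
def AA5 (v : Fin 6 → ℂ) : ℂ := -(v 3) ^ 2 - 2 * v 0 * v 5
def AA6 (v : Fin 6 → ℂ) : ℂ := -(v 5) ^ 2 - 2 * v 2 * v 4

def DD0 (v : Fin 6 → ℂ) : ℂ := v 0 * v 1 * v 2
def DD1 (v : Fin 6 → ℂ) : ℂ := 2 * v 1 * (v 2) ^ 2 + (v 1) ^ 2 * v 5 - (v 3) ^ 2 * v 4 + v 0 * v 4 * v 5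
def DD2 (v : Fin 6 → ℂ) : ℂ := -(v 5) ^ 3 + (v 1) ^ 2 * v 3 - 2 * v 1 * (v 4) ^ 2 + v 0 * v 3 * v 4 + 3 * v 2 * v 4 * v 5
def DD3 (v : Fin 6 → ℂ) : ℂ := 2 * v 0 * (v 1) ^ 2 + (v 0) ^ 2 * v 4 - v 3 * (v 5) ^ 2 + v 2 * v 3 * v 4
def DD4 (v : Fin 6 → ℂ) : ℂ := -(v 1) ^ 2 * v 2 + v 0 * (v 5) ^ 2 - 2 * (v 3) ^ 2 * v 5 - v 0 * v 2 * v 4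
def DD5 (v : Fin 6 → ℂ) : ℂ := -(v 3) ^ 3 + (v 2) ^ 2 * v 4 - 2 * v 2 * (v 5) ^ 2 + v 1 * v 4 * v 5 + 3 * v 0 * v 3 * v 5
def DD6 (v : Fin 6 → ℂ) : ℂ := -(v 4) ^ 3 + (v 0) ^ 2 * v 5 - 2 * v 0 * (v 3) ^ 2 + v 2 * v 3 * v 5 + 3 * v 1 * v 3 * v 4
def DD7 (v : Fin 6 → ℂ) : ℂ := -(v 1) ^ 3 + v 2 * (v 3) ^ 2 - v 0 * v 2 * v 5 - 3 * v 0 * v 1 * v 4 + 2 * (v 0) ^ 2 * v 3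
def DD8 (v : Fin 6 → ℂ) : ℂ := -(v 0) ^ 3 + v 1 * (v 5) ^ 2 - v 1 * v 2 * v 4 - 3 * v 0 * v 2 * v 3 + 2 * (v 2) ^ 2 * v 5
def DD9 (v : Fin 6 → ℂ) : ℂ := 2 * (v 0) ^ 2 * v 2 + (v 2) ^ 2 * v 3 - (v 4) ^ 2 * v 5 + v 1 * v 3 * v 5
def DD10 (v : Fin 6 → ℂ) : ℂ := -(v 0) * (v 2) ^ 2 + v 1 * (v 3) ^ 2 - 2 * v 3 * (v 4) ^ 2 - v 0 * v 1 * v 5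
def DD11 (v : Fin 6 → ℂ) : ℂ := -(v 2) ^ 3 + v 0 * (v 4) ^ 2 - v 0 * v 1 * v 3 - 3 * v 1 * v 2 * v 5 + 2 * (v 1) ^ 2 * v 4
def DD12 (v : Fin 6 → ℂ) : ℂ := -(v 0) ^ 2 * v 1 + v 2 * (v 4) ^ 2 - 2 * v 4 * (v 5) ^ 2 - v 1 * v 2 * v 3
def DDinf (v : Fin 6 → ℂ) : ℂ := v 3 * v 4 * v 5

def GG0 (v : Fin 6 → ℂ) : ℂ := (DD0 v) ^ 2 + (DDinf v) ^ 2
def GG1 (v : Fin 6 → ℂ) : ℂ := -(DD7 v) ^ 2 + 2 * DD0 v * DD1 v + 10 * DDinf v * DD1 v + 2 * DD2 v * DD12 v - 2 * DD3 v * DD11 v - 4 * DD4 v * DD10 v - 2 * DD9 v * DD5 v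
def GG2 (v : Fin 6 → ℂ) : ℂ := -2 * (DD1 v) ^ 2 - 4 * DD0 v * DD2 v + 6 * DDinf v * DD2 v - 2 * DD4 v * DD11 v + 2 * DD5 v * DD10 v - 2 * DD6 v * DD9 v - 2 * DD7 v * DD8 v
def GG3 (v : Fin 6 → ℂ) : ℂ := -(DD8 v) ^ 2 + 2 * DD0 v * DD3 v + 10 * DDinf v * DD3 v + 2 * DD6 v * DD10 v - 2 * DD9 v * DD7 v - 4 * DD12 v * DD4 v - 2 * DD1 v * DD2 v
def GG4 (v : Fin 6 → ℂ) : ℂ := -(DD2 v) ^ 2 + 10 * DD0 v * DD4 v - 2 * DDinf v * DD4 v + 2 * DD5 v * DD12 v - 2 * DD9 v * DD8 v - 4 * DD1 v * DD3 v - 2 * DD10 v * DD7 v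
def GG5 (v : Fin 6 → ℂ) : ℂ := -2 * (DD9 v) ^ 2 - 4 * DD0 v * DD5 v + 6 * DDinf v * DD5 v - 2 * DD10 v * DD8 v + 2 * DD6 v * DD12 v - 2 * DD2 v * DD3 v - 2 * DD11 v * DD7 v
def GG6 (v : Fin 6 → ℂ) : ℂ := -2 * (DD3 v) ^ 2 - 4 * DD0 v * DD6 v + 6 * DDinf v * DD6 v - 2 * DD12 v * DD7 v + 2 * DD2 v * DD4 v - 2 * DD5 v * DD1 v - 2 * DD8 v * DD11 v
def GG7 (v : Fin 6 → ℂ) : ℂ := -2 * (DD10 v) ^ 2 + 6 * DD0 v * DD7 v + 4 * DDinf v * DD7 v - 2 * DD1 v * DD6 v - 2 * DD2 v * DD5 v - 2 * DD8 v * DD12 v - 2 * DD9 v * DD11 v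
def GG8 (v : Fin 6 → ℂ) : ℂ := -2 * (DD4 v) ^ 2 + 6 * DD0 v * DD8 v + 4 * DDinf v * DD8 v - 2 * DD3 v * DD5 v - 2 * DD6 v * DD2 v - 2 * DD11 v * DD10 v - 2 * DD1 v * DD7 v
def GG9 (v : Fin 6 → ℂ) : ℂ := -(DD11 v) ^ 2 + 2 * DD0 v * DD9 v + 10 * DDinf v * DD9 v + 2 * DD5 v * DD4 v - 2 * DD1 v * DD8 v - 4 * DD10 v * DD12 v - 2 * DD3 v * DD6 v
def GG10 (v : Fin 6 → ℂ) : ℂ := -(DD5 v) ^ 2 + 10 * DD0 v * DD10 v - 2 * DDinf v * DD10 v + 2 * DD6 v * DD4 v - 2 * DD3 v * DD7 v - 4 * DD9 v * DD1 v - 2 * DD12 v * DD11 v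
def GG11 (v : Fin 6 → ℂ) : ℂ := -2 * (DD12 v) ^ 2 + 6 * DD0 v * DD11 v + 4 * DDinf v * DD11 v - 2 * DD9 v * DD2 v - 2 * DD5 v * DD6 v - 2 * DD7 v * DD4 v - 2 * DD3 v * DD8 v
def GG12 (v : Fin 6 → ℂ) : ℂ := -(DD6 v) ^ 2 + 10 * DD0 v * DD12 v - 2 * DDinf v * DD12 v + 2 * DD2 v * DD10 v - 2 * DD1 v * DD11 v - 4 * DD3 v * DD9 v - 2 * DD4 v * DD8 v

def wInf (v : Fin 6 → ℂ) : ℂ := 13 * (AA0 v) ^ 2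
def wF (ν : ℕ) (v : Fin 6 → ℂ) : ℂ :=
  (AA0 v + ζ ^ ν * AA1 v + ζ ^ (4 * ν) * AA2 v + ζ ^ (9 * ν) * AA3 v + ζ ^ (3 * ν) * AA4 v
    + ζ ^ (12 * ν) * AA5 v + ζ ^ (10 * ν) * AA6 v) ^ 2
def dInf (v : Fin 6 → ℂ) : ℂ := 13 ^ 2 * GG0 v
def dF (ν : ℕ) (v : Fin 6 → ℂ) : ℂ :=
  -13 * GG0 v + ζ ^ ν * GG1 v + ζ ^ (2 * ν) * GG2 v + ζ ^ (3 * ν) * GG3 v + ζ ^ (4 * ν) * GG4 v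
    + ζ ^ (5 * ν) * GG5 v + ζ ^ (6 * ν) * GG6 v + ζ ^ (7 * ν) * GG7 v + ζ ^ (8 * ν) * GG8 v
    + ζ ^ (9 * ν) * GG9 v + ζ ^ (10 * ν) * GG10 v + ζ ^ (11 * ν) * GG11 v + ζ ^ (12 * ν) * GG12 v

def Phi12 (v : Fin 6 → ℂ) : ℂ :=
  -(1 / (13 * 52) : ℂ) * ((∑ ν ∈ Finset.range 13, (dF ν v) ^ 2) + (dInf v) ^ 2)
def Phi18 (v : Fin 6 → ℂ) : ℂ :=
  (1 / (13 * 6) : ℂ) * ((∑ ν ∈ Finset.range 13, (dF ν v) ^ 3) + (dInf v) ^ 3)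
def Phi30 (v : Fin 6 → ℂ) : ℂ :=
  -(1 / (13 * 1315) : ℂ) * ((∑ ν ∈ Finset.range 13, (dF ν v) ^ 5) + (dInf v) ^ 5)
def Phi42 (v : Fin 6 → ℂ) : ℂ :=
  (1 / (13 * 226842) : ℂ) * ((∑ ν ∈ Finset.range 13, (dF ν v) ^ 7) + (dInf v) ^ 7)

def Phi20 (v : Fin 6 → ℂ) : ℂ :=
  (1 / (13 * 25) : ℂ) * ((∑ ν ∈ Finset.range 13, (wF ν v) ^ 5) + (wInf v) ^ 5)
def Phi32 (v : Fin 6 → ℂ) : ℂ :=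
  -(1 / (13 * 1840) : ℂ) * ((∑ ν ∈ Finset.range 13, (wF ν v) ^ 8) + (wInf v) ^ 8)
def Phi44 (v : Fin 6 → ℂ) : ℂ :=
  (1 / (13 * 146905) : ℂ) * ((∑ ν ∈ Finset.range 13, (wF ν v) ^ 11) + (wInf v) ^ 11)

def th13 (c : ℚ) (k : ℤ) (z : ℂ) : ℂ :=
  Complex.exp (2 * Real.pi * Complex.I * (c : ℂ) * z) *
    ∑' n : ℤ, (-1 : ℂ) ^ n *
      Complex.exp (2 * Real.pi * Complex.I * (((13 * n ^ 2 + k * n : ℤ) : ℂ) / 2) * z)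

def ta : Fin 6 → ℂ → ℂ :=
  ![th13 (121 / 104) 11, th13 (49 / 104) 7, th13 (25 / 104) 5,
    fun z => -th13 (9 / 104) 3 z, th13 (81 / 104) 9, th13 (1 / 104) 1]

def AV (z : ℂ) : Fin 6 → ℂ := fun i => ta i z

def etaF (z : ℂ) : ℂ :=
  Complex.exp (2 * Real.pi * Complex.I * z / 24) *
    ∏' n : ℕ, (1 - Complex.exp (2 * Real.pi * Complex.I * z) ^ (n + 1))

def xV (z : ℂ) : Fin 6 → ℂ := fun i => etaF z * ta i z

def Δfun (z : ℂ) : ℂ := (etaF z) ^ 24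

def Eis (k : ℕ) (z : ℂ) : ℂ :=
  (1 / 2 : ℂ) * ∑' p : {p : ℤ × ℤ // Int.gcd p.1 p.2 = 1},
    1 / ((p.val.1 : ℂ) * z + (p.val.2 : ℂ)) ^ k

/-- The standard additive character of `ZMod 13`. -/
abbrev psi13 : AddChar (ZMod 13) ℂ := ZMod.stdAddChar

def fourier13 (F : ZMod 13 → ℂ) (k : ZMod 13) : ℂ := ∑ l, psi13 (k * l) * F l

def chirp (a : ZMod 13) (F : ZMod 13 → ℂ) (k : ZMod 13) : ℂ := psi13 (a * k ^ 2) * F k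

def sexticForm (F : ZMod 13 → ℂ) : ℂ := (F 1 * F 3 * F 9) ^ 2 + (F 2 * F 6 * F 5) ^ 2

def orbitForm (F : ZMod 13 → ℂ) : ℂ :=
  13 ^ 6 * sexticForm F ^ 2 + ∑ a, sexticForm (fourier13 (chirp a F)) ^ 2

def gauss13 (a : ZMod 13) : ℂ := ∑ j, psi13 (a * j ^ 2)

instance : Fact (Nat.Prime 13) := ⟨by norm_num⟩

theorem sum_psi13_mul (b : ZMod 13) : ∑ y, psi13 (b * y) = if b = 0 then 13 else 0 := by
  have := AddChar.sum_mulShift b (ZMod.isPrimitive_stdAddChar 13)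
  simpa [mul_comm b] using this

theorem gauss13_sq {a : ZMod 13} (ha : a ≠ 0) : gauss13 a ^ 2 = 13 := by
  have h2 : (2 : ZMod 13) ≠ 0 := by decide
  calc gauss13 a ^ 2 = ∑ x, ∑ y, psi13 (a * x ^ 2) * psi13 (a * (5 * y) ^ 2) := by
        rw [pow_two]
        nth_rw 2 [gauss13]
        rw [← Equiv.sum_comp (Equiv.mulLeft₀ (5 : ZMod 13) (by decide)), gauss13,
          Finset.sum_mul_sum]
        rfl
    _ = ∑ y, ∑ u, psi13 (a * (u + y) ^ 2) * psi13 (a * (5 * y) ^ 2) := by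
        rw [Finset.sum_comm]
        refine Finset.sum_congr rfl fun y _ ↦ ?_
        exact (Equiv.sum_comp (Equiv.addRight y)
          fun x ↦ psi13 (a * x ^ 2) * psi13 (a * (5 * y) ^ 2)).symm
    _ = ∑ u, psi13 (a * u ^ 2) * ∑ y, psi13 (2 * a * u * y) := by
        rw [Finset.sum_comm]
        refine Finset.sum_congr rfl fun u _ ↦ ?_
        rw [Finset.mul_sum]
        refine Finset.sum_congr rfl fun y _ ↦ ?_
        rw [← AddChar.map_add_eq_mul, ← AddChar.map_add_eq_mul]
        congr 1
        have : (26 : ZMod 13) = 0 := by decide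
        linear_combination a * y ^ 2 * this
    _ = 13 := by
        simp_rw [sum_psi13_mul, mul_eq_zero, ha, h2, false_or]
        simp

theorem fourier13_chirp_fourier13 {a : ZMod 13} (ha : a ≠ 0) (F : ZMod 13 → ℂ) (k : ZMod 13) :
    fourier13 (chirp a (fourier13 F)) k =
      gauss13 a * psi13 (-(4 * a)⁻¹ * k ^ 2) *
        fourier13 (chirp (-(4 * a)⁻¹) F) (-(2 * a)⁻¹ * k) := by
  have h2 : (2 : ZMod 13) ≠ 0 := by decide
  have h4 : (4 : ZMod 13) ≠ 0 := by decide
  simp only [fourier13, chirp, Finset.mul_sum]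
  rw [Finset.sum_comm]
  refine Finset.sum_congr rfl fun l _ ↦ ?_
  have : gauss13 a = ∑ j, psi13 (a * (j + (2 * a)⁻¹ * (k + l)) ^ 2) :=
    (Equiv.sum_comp (Equiv.addRight ((2 * a)⁻¹ * (k + l))) fun j ↦ psi13 (a * j ^ 2)).symm
  rw [this]
  simp only [Finset.sum_mul, ← mul_assoc, ← AddChar.map_add_eq_mul]
  refine Finset.sum_congr rfl fun j _ ↦ ?_
  congr 2
  have h42 : (4 : ZMod 13) = 2 * 2 := by decide
  rw [h42]
  field_simp
  ring

theorem fourier13_odd {F : ZMod 13 → ℂ} (hF : ∀ k, F (-k) = -F k) (k : ZMod 13) :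
    fourier13 F (-k) = -fourier13 F k := by
  rw [fourier13, ← Equiv.sum_comp (Equiv.neg _), fourier13, ← Finset.sum_neg_distrib]
  simp [hF]

theorem chirp_odd (a : ZMod 13) {F : ZMod 13 → ℂ} (hF : ∀ k, F (-k) = -F k) (k : ZMod 13) :
    chirp a F (-k) = -chirp a F k := by
  simp [chirp, hF]

theorem fourier13_fourier13 (F : ZMod 13 → ℂ) (k : ZMod 13) :
    fourier13 (fourier13 F) k = 13 * F (-k) := by
  simp only [fourier13, Finset.mul_sum]
  rw [Finset.sum_comm]
  simp_rw [← mul_assoc, ← AddChar.map_add_eq_mul, ← Finset.sum_mul]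
  have (l : ZMod 13) : ∑ j, psi13 (k * j + j * l) = if l = -k then 13 else 0 := by
    have h : ∀ j, k * j + j * l = (k + l) * j := fun j ↦ by ring
    simp_rw [h, sum_psi13_mul, eq_neg_iff_add_eq_zero, add_comm]
  simp [this]

theorem chirp_chirp (a b : ZMod 13) (F : ZMod 13 → ℂ) : chirp a (chirp b F) = chirp (a + b) F := by
  ext k
  simp only [chirp, ← mul_assoc, ← AddChar.map_add_eq_mul]
  ring_nf

theorem fourier13_const_mul (c : ℂ) (F : ZMod 13 → ℂ) (k : ZMod 13) :
    fourier13 (fun j ↦ c * F j) k = c * fourier13 F k := by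
  simp only [fourier13, Finset.mul_sum]
  exact Finset.sum_congr rfl fun _ _ ↦ by ring

theorem chirp_const_mul (a : ZMod 13) (c : ℂ) (F : ZMod 13 → ℂ) :
    chirp a (fun j ↦ c * F j) = fun j ↦ c * chirp a F j := by
  ext; simp only [chirp]; ring

theorem sexticForm_const_mul (c : ℂ) (F : ZMod 13 → ℂ) :
    sexticForm (fun j ↦ c * F j) = c ^ 6 * sexticForm F := by
  simp only [sexticForm]; ring

theorem sexticForm_chirp (a : ZMod 13) (F : ZMod 13 → ℂ) :
    sexticForm (chirp a F) = sexticForm F := by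
  have key (x y z : ZMod 13) (h : x ^ 2 + y ^ 2 + z ^ 2 = 0) :
      chirp a F x * chirp a F y * chirp a F z = F x * F y * F z := by
    have : psi13 (a * x ^ 2) * psi13 (a * y ^ 2) * psi13 (a * z ^ 2) = 1 := by
      rw [← AddChar.map_add_eq_mul, ← AddChar.map_add_eq_mul, ← mul_add, ← mul_add, h]
      simp
    simp only [chirp]
    linear_combination F x * F y * F z * this
  rw [sexticForm, key 1 3 9 (by decide), key 2 6 5 (by decide), sexticForm]

theorem sexticForm_dilate {F : ZMod 13 → ℂ} (hF : ∀ k, F (-k) = -F k) {u : ZMod 13} (hu : u ≠ 0) :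
    sexticForm (fun k ↦ F (u * k)) = sexticForm F := by
  have h7 : F 7 = -F 6 := hF 6
  have h8 : F 8 = -F 5 := hF 5
  have h9 : F 9 = -F 4 := hF 4
  have h10 : F 10 = -F 3 := hF 3
  have h11 : F 11 = -F 2 := hF 2
  have h12 : F 12 = -F 1 := hF 1
  have hv : ∀ u : ZMod 13, u ≠ 0 → u = 1 ∨ u = 2 ∨ u = 3 ∨ u = 4 ∨ u = 5 ∨ u = 6 ∨ u = 7 ∨ u = 8 ∨
    u = 9 ∨ u = 10 ∨ u = 11 ∨ u = 12 := by decide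
  rcases hv u hu with rfl | rfl | rfl | rfl | rfl | rfl | rfl | rfl | rfl | rfl | rfl | rfl <;>
    simp only [sexticForm] <;> reduce_mod_char <;> simp only [h7, h8, h9, h10, h11, h12] <;> ring

theorem orbitForm_const_mul (c : ℂ) (F : ZMod 13 → ℂ) :
    orbitForm (fun j ↦ c * F j) = c ^ 12 * orbitForm F := by
  have (a : ZMod 13) : fourier13 (chirp a fun j ↦ c * F j) = fun j ↦ c * fourier13 (chirp a F) j := by
    ext; rw [chirp_const_mul, fourier13_const_mul]
  simp only [orbitForm, this, sexticForm_const_mul, mul_add, Finset.mul_sum]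
  congr 1
  · ring
  · exact Finset.sum_congr rfl fun _ _ ↦ by ring

theorem orbitForm_chirp (a : ZMod 13) (F : ZMod 13 → ℂ) : orbitForm (chirp a F) = orbitForm F := by
  simp only [orbitForm, sexticForm_chirp, chirp_chirp]
  exact congrArg _
    (Equiv.sum_comp (Equiv.addRight a) fun b ↦ sexticForm (fourier13 (chirp b F)) ^ 2)

theorem orbitForm_fourier13 {F : ZMod 13 → ℂ} (hF : ∀ k, F (-k) = -F k) :
    orbitForm (fourier13 F) = 13 ^ 6 * orbitForm F := by
  set Q : ZMod 13 → ℂ := fun a ↦ sexticForm (fourier13 (chirp a F)) ^ 2 with hQ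
  have hchirp0 (G : ZMod 13 → ℂ) : chirp 0 G = G := by ext; simp [chirp]
  have h0 : sexticForm (fourier13 (chirp 0 (fourier13 F))) ^ 2 = 13 ^ 12 * sexticForm F ^ 2 := by
    rw [hchirp0, show fourier13 (fourier13 F) = fun k ↦ (-13) * F k from
      funext fun k ↦ by rw [fourier13_fourier13, hF]; ring, sexticForm_const_mul]
    ring
  have hne {a : ZMod 13} (ha : a ≠ 0) :
      sexticForm (fourier13 (chirp a (fourier13 F))) ^ 2 = 13 ^ 6 * Q (-(4 * a)⁻¹) := by
    have h2 : -(2 * a)⁻¹ ≠ 0 := neg_ne_zero.2 (inv_ne_zero (mul_ne_zero (by decide) ha))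
    have : fourier13 (chirp a (fourier13 F)) = fun k ↦ gauss13 a * chirp (-(4 * a)⁻¹)
        (fun k ↦ fourier13 (chirp (-(4 * a)⁻¹) F) (-(2 * a)⁻¹ * k)) k := by
      ext k; rw [fourier13_chirp_fourier13 ha, chirp, mul_assoc]
    rw [this, sexticForm_const_mul, sexticForm_chirp,
      sexticForm_dilate (fourier13_odd (chirp_odd _ hF)) h2, hQ, mul_pow, ← pow_mul,
      show 6 * 2 = 2 * 6 from rfl, pow_mul, gauss13_sq ha]
  have hinv : ∀ a : ZMod 13, (-(4 * (-(4 * a)⁻¹))⁻¹) = a := fun a ↦ by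
    have h4 : (4 : ZMod 13) ≠ 0 := by decide
    rw [mul_inv, inv_neg, inv_inv, mul_neg, neg_neg, inv_mul_cancel_left₀ h4]
  let e : Equiv.Perm (ZMod 13) := ⟨fun a ↦ -(4 * a)⁻¹, fun a ↦ -(4 * a)⁻¹, hinv, hinv⟩
  have he : ∑ a, Q (e a) = ∑ a, Q a := Equiv.sum_comp e Q
  rw [← Finset.add_sum_erase _ _ (Finset.mem_univ 0)] at he
  have hQ0 : Q (e 0) = Q 0 := by simp [e]
  have hsum : ∑ a, sexticForm (fourier13 (chirp a (fourier13 F))) ^ 2 =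
      13 ^ 12 * sexticForm F ^ 2 + 13 ^ 6 * ∑ a ∈ Finset.univ.erase 0, Q (e a) := by
    rw [← Finset.add_sum_erase _ _ (Finset.mem_univ 0), h0, Finset.mul_sum]
    congr 1
    exact Finset.sum_congr rfl fun a ha ↦ hne (Finset.ne_of_mem_erase ha)
  have hQ0' : Q 0 = sexticForm (fourier13 F) ^ 2 := by simp only [hQ, hchirp0]
  rw [orbitForm, orbitForm, hsum, ← hQ0']
  linear_combination 13 ^ 6 * he - 13 ^ 6 * hQ0

theorem zeta_pow_thirteen : ζ ^ 13 = 1 := by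
  rw [ζ, ← Complex.exp_nat_mul]
  convert! Complex.exp_two_pi_mul_I using 2
  push_cast
  ring

theorem zeta_geom_sum : ∑ i ∈ Finset.range 13, ζ ^ i = 0 :=
  (Complex.isPrimitiveRoot_exp 13 (by norm_num)).geom_sum_eq_zero (by norm_num)

theorem psi13_natCast (n : ℕ) : psi13 n = ζ ^ n := by
  have := ZMod.stdAddChar_coe (N := 13) n
  rw [Int.cast_natCast] at this
  rw [ζ, ← Complex.exp_nat_mul]
  convert! this using 2
  · push_cast
    ring

theorem psi13_natCast_mul (n : ℕ) (l : ZMod 13) : psi13 (n * l) = ζ ^ (n * l.val) := by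
  rw [← psi13_natCast]
  simp

/-- The odd function on `ZMod 13` with coordinates `v`. -/
def oddVec (v : Fin 6 → ℂ) : ZMod 13 → ℂ :=
  (![0, v 0, -v 4, v 1, -v 2, -v 3, -v 5, v 5, v 3, v 2, -v 1, v 4, -v 0] : Fin 13 → ℂ)

theorem oddVec_neg (v : Fin 6 → ℂ) (k : ZMod 13) : oddVec v (-k) = -oddVec v k := by
  have h0 : (0 : ℂ) = -0 := by simp
  have hn (x : ℂ) : x = - -x := by simp
  fin_cases k
  exacts [h0, rfl, hn _, rfl, hn _, hn _, hn _, rfl, rfl, rfl, hn _, rfl, hn _]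

theorem fourier13_oddVec (v : Fin 6 → ℂ) (n : ℕ) :
    fourier13 (oddVec v) n = (ζ ^ n - ζ ^ (12 * n)) * v 0 - (ζ ^ (2 * n) - ζ ^ (11 * n)) * v 4
      + (ζ ^ (3 * n) - ζ ^ (10 * n)) * v 1 - (ζ ^ (4 * n) - ζ ^ (9 * n)) * v 2
      - (ζ ^ (5 * n) - ζ ^ (8 * n)) * v 3 - (ζ ^ (6 * n) - ζ ^ (7 * n)) * v 5 := by
  simp only [fourier13, psi13_natCast_mul]
  have : ∑ l : ZMod 13, ζ ^ (n * l.val) * oddVec v l = ∑ l : Fin 13, ζ ^ (n * (l : ℕ)) *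
    (![0, v 0, -v 4, v 1, -v 2, -v 3, -v 5, v 5, v 3, v 2, -v 1, v 4, -v 0] : Fin 13 → ℂ) l := rfl
  rw [this]
  simp [Fin.sum_univ_succ]
  ring

theorem zeta_pow_mod (n : ℕ) : ζ ^ n = ζ ^ (n % 13) := by
  conv_lhs => rw [← Nat.div_add_mod n 13, pow_add, pow_mul, zeta_pow_thirteen, one_pow, one_mul]

theorem fourier13_oddVec' (v : Fin 6 → ℂ) (n : ℕ) :
    fourier13 (oddVec v) n = (ζ ^ (n % 13) - ζ ^ (12 * n % 13)) * v 0
      - (ζ ^ (2 * n % 13) - ζ ^ (11 * n % 13)) * v 4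
      + (ζ ^ (3 * n % 13) - ζ ^ (10 * n % 13)) * v 1
      - (ζ ^ (4 * n % 13) - ζ ^ (9 * n % 13)) * v 2
      - (ζ ^ (5 * n % 13) - ζ ^ (8 * n % 13)) * v 3
      - (ζ ^ (6 * n % 13) - ζ ^ (7 * n % 13)) * v 5 := by
  simp only [fourier13_oddVec, ← zeta_pow_mod]

/-- Reduction of the exponents that occur in products of three linear forms. -/
theorem pow_reduce {t : ℂ} (ht : t ^ 13 = 1) :
    t ^ 13 = t ^ 0 ∧ t ^ 14 = t ^ 1 ∧ t ^ 15 = t ^ 2 ∧ t ^ 16 = t ^ 3 ∧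
    t ^ 17 = t ^ 4 ∧ t ^ 18 = t ^ 5 ∧ t ^ 19 = t ^ 6 ∧ t ^ 20 = t ^ 7 ∧
    t ^ 21 = t ^ 8 ∧ t ^ 22 = t ^ 9 ∧ t ^ 23 = t ^ 10 ∧ t ^ 24 = t ^ 11 ∧
    t ^ 25 = t ^ 12 ∧ t ^ 26 = t ^ 0 ∧ t ^ 27 = t ^ 1 ∧ t ^ 28 = t ^ 2 ∧
    t ^ 29 = t ^ 3 ∧ t ^ 30 = t ^ 4 ∧ t ^ 31 = t ^ 5 ∧ t ^ 32 = t ^ 6 ∧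
    t ^ 33 = t ^ 7 ∧ t ^ 34 = t ^ 8 ∧ t ^ 35 = t ^ 9 ∧ t ^ 36 = t ^ 10 := by
  have h (n : ℕ) : t ^ n = t ^ (n % 13) := by
    conv_lhs => rw [← Nat.div_add_mod n 13, pow_add, pow_mul, ht, one_pow, one_mul]
  refine ⟨?_, ?_, ?_, ?_, ?_, ?_, ?_, ?_, ?_, ?_, ?_, ?_, ?_, ?_, ?_, ?_, ?_, ?_, ?_, ?_, ?_, ?_,
      ?_, ?_⟩ <;> exact h _

def periodA : ℂ := ζ + ζ ^ 3 + ζ ^ 9 - ζ ^ 4 - ζ ^ 12 - ζ ^ 10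

def periodB : ℂ := ζ ^ 2 + ζ ^ 6 + ζ ^ 5 - ζ ^ 8 - ζ ^ 11 - ζ ^ 7

theorem periodA_sq_add_periodB_sq : periodA ^ 2 + periodB ^ 2 = -13 := by
  have h := zeta_geom_sum
  simp only [Finset.sum_range_succ, Finset.sum_range_zero] at h
  rw [periodA, periodB]
  ring_nf
  simp only [pow_reduce zeta_pow_thirteen]
  linear_combination h

set_option maxRecDepth 20000 in
theorem fourier13_oddVec_prod₁ (v : Fin 6 → ℂ) :
    fourier13 (oddVec v) 1 * fourier13 (oddVec v) 3 * fourier13 (oddVec v) 9 =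
      (3 * periodB - 2 * periodA) * DD0 v + (3 * periodA + 2 * periodB) * DDinf v
        - (periodA + periodB) * (DD1 v + DD3 v + DD9 v) - periodA * (DD2 v + DD5 v + DD6 v)
        + (periodA - periodB) * (DD4 v + DD10 v + DD12 v)
        - periodB * (DD7 v + DD8 v + DD11 v) := by
  have h1 : fourier13 (oddVec v) 1 = (ζ ^ 1 - ζ ^ 12) * v 0 - (ζ ^ 2 - ζ ^ 11) * v 4
      + (ζ ^ 3 - ζ ^ 10) * v 1 - (ζ ^ 4 - ζ ^ 9) * v 2
      - (ζ ^ 5 - ζ ^ 8) * v 3 - (ζ ^ 6 - ζ ^ 7) * v 5 := by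
    exact_mod_cast fourier13_oddVec' v 1
  have h3 : fourier13 (oddVec v) 3 = (ζ ^ 3 - ζ ^ 10) * v 0 - (ζ ^ 6 - ζ ^ 7) * v 4
      + (ζ ^ 9 - ζ ^ 4) * v 1 - (ζ ^ 12 - ζ ^ 1) * v 2
      - (ζ ^ 2 - ζ ^ 11) * v 3 - (ζ ^ 5 - ζ ^ 8) * v 5 := by
    exact_mod_cast fourier13_oddVec' v 3
  have h9 : fourier13 (oddVec v) 9 = (ζ ^ 9 - ζ ^ 4) * v 0 - (ζ ^ 5 - ζ ^ 8) * v 4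
      + (ζ ^ 1 - ζ ^ 12) * v 1 - (ζ ^ 10 - ζ ^ 3) * v 2
      - (ζ ^ 6 - ζ ^ 7) * v 3 - (ζ ^ 2 - ζ ^ 11) * v 5 := by
    exact_mod_cast fourier13_oddVec' v 9
  rw [h1, h3, h9, periodA, periodB]
  simp only [DD0, DD1, DD2, DD3, DD4, DD5, DD6, DD7, DD8, DD9, DD10, DD11, DD12, DDinf]
  ring_nf
  simp only [pow_reduce zeta_pow_thirteen]
  ring

set_option maxRecDepth 20000 in
theorem fourier13_oddVec_prod₂ (v : Fin 6 → ℂ) :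
    fourier13 (oddVec v) 2 * fourier13 (oddVec v) 6 * fourier13 (oddVec v) 5 =
      -(3 * periodA + 2 * periodB) * DD0 v + (3 * periodB - 2 * periodA) * DDinf v
        + (periodA - periodB) * (DD1 v + DD3 v + DD9 v) - periodB * (DD2 v + DD5 v + DD6 v)
        + (periodA + periodB) * (DD4 v + DD10 v + DD12 v)
        + periodA * (DD7 v + DD8 v + DD11 v) := by
  have h2 : fourier13 (oddVec v) 2 = (ζ ^ 2 - ζ ^ 11) * v 0 - (ζ ^ 4 - ζ ^ 9) * v 4
      + (ζ ^ 6 - ζ ^ 7) * v 1 - (ζ ^ 8 - ζ ^ 5) * v 2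
      - (ζ ^ 10 - ζ ^ 3) * v 3 - (ζ ^ 12 - ζ ^ 1) * v 5 := by
    exact_mod_cast fourier13_oddVec' v 2
  have h6 : fourier13 (oddVec v) 6 = (ζ ^ 6 - ζ ^ 7) * v 0 - (ζ ^ 12 - ζ ^ 1) * v 4
      + (ζ ^ 5 - ζ ^ 8) * v 1 - (ζ ^ 11 - ζ ^ 2) * v 2
      - (ζ ^ 4 - ζ ^ 9) * v 3 - (ζ ^ 10 - ζ ^ 3) * v 5 := by
    exact_mod_cast fourier13_oddVec' v 6
  have h5 : fourier13 (oddVec v) 5 = (ζ ^ 5 - ζ ^ 8) * v 0 - (ζ ^ 10 - ζ ^ 3) * v 4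
      + (ζ ^ 2 - ζ ^ 11) * v 1 - (ζ ^ 7 - ζ ^ 6) * v 2
      - (ζ ^ 12 - ζ ^ 1) * v 3 - (ζ ^ 4 - ζ ^ 9) * v 5 := by
    exact_mod_cast fourier13_oddVec' v 5
  rw [h2, h6, h5, periodA, periodB]
  simp only [DD0, DD1, DD2, DD3, DD4, DD5, DD6, DD7, DD8, DD9, DD10, DD11, DD12, DDinf]
  ring_nf
  simp only [pow_reduce zeta_pow_thirteen]
  ring

theorem sexticForm_fourier13_oddVec (v : Fin 6 → ℂ) :
    sexticForm (fourier13 (oddVec v)) = 13 * dF 0 v := by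
  suffices h : sexticForm (fourier13 (oddVec v)) = (periodA ^ 2 + periodB ^ 2) * -dF 0 v by
    rw [h, periodA_sq_add_periodB_sq]
    ring
  rw [sexticForm, fourier13_oddVec_prod₁, fourier13_oddVec_prod₂]
  simp only [dF, GG0, GG1, GG2, GG3, GG4, GG5, GG6, GG7, GG8, GG9, GG10, GG11, GG12, mul_zero,
    pow_zero]
  ring

/-- The coordinates of `chirp (7 * n) (oddVec v)`, for `t = ζ ^ n`. -/
def twist (t : ℂ) (v : Fin 6 → ℂ) : Fin 6 → ℂ :=
  ![t ^ 7 * v 0, t ^ 11 * v 1, t ^ 8 * v 2, t ^ 6 * v 3, t ^ 2 * v 4, t ^ 5 * v 5]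

theorem chirp_oddVec (n : ℕ) (v : Fin 6 → ℂ) :
    chirp (7 * n) (oddVec v) = oddVec (twist (ζ ^ n) v) := by
  have key (m : ℕ) (k : ZMod 13) (x : ℂ) (h : 7 * k ^ 2 = m) :
      psi13 (7 * n * k ^ 2) * x = (ζ ^ n) ^ m * x := by
    rw [mul_right_comm, h, ← pow_mul, ← psi13_natCast]
    push_cast
    ring_nf
  have key' (m : ℕ) (k : ZMod 13) (x : ℂ) (h : 7 * k ^ 2 = m) :
      psi13 (7 * n * k ^ 2) * -x = -((ζ ^ n) ^ m * x) := by
    rw [key m k _ h, mul_neg]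
  ext k
  fin_cases k
  exacts [mul_zero _, key 7 1 _ (by decide), key' 2 2 _ (by decide), key 11 3 _ (by decide),
    key' 8 4 _ (by decide), key' 6 5 _ (by decide), key' 5 6 _ (by decide), key 5 7 _ (by decide),
    key 6 8 _ (by decide), key 8 9 _ (by decide), key' 11 10 _ (by decide), key 2 11 _ (by decide),
    key' 7 12 _ (by decide)]

set_option linter.unusedSimpArgs false in
theorem dF_twist (n : ℕ) (v : Fin 6 → ℂ) : dF 0 (twist (ζ ^ n) v) = dF n v := by
  obtain ⟨t, ht, hζ⟩ : ∃ t, t ^ 13 = 1 ∧ t = ζ ^ n :=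
    ⟨ζ ^ n, by rw [pow_right_comm, zeta_pow_thirteen, one_pow], rfl⟩
  have e (k : ℕ) : ζ ^ (k * n) = t ^ k := by rw [hζ, ← pow_mul, mul_comm]
  have hr := pow_reduce ht
  have d0 : DD0 (twist t v) = DD0 v := by
    simp only [twist, DD0, Matrix.cons_val]
    ring_nf
    simp only [hr]
    ring
  have dinf : DDinf (twist t v) = DDinf v := by
    simp only [twist, DDinf, Matrix.cons_val]
    ring_nf
    simp only [hr]
    ring
  have d1 : DD1 (twist t v) = t ^ 1 * DD1 v := by
    simp only [twist, DD1, Matrix.cons_val]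
    ring_nf
    simp only [hr]
    ring
  have d2 : DD2 (twist t v) = t ^ 2 * DD2 v := by
    simp only [twist, DD2, Matrix.cons_val]
    ring_nf
    simp only [hr]
    ring
  have d3 : DD3 (twist t v) = t ^ 3 * DD3 v := by
    simp only [twist, DD3, Matrix.cons_val]
    ring_nf
    simp only [hr]
    ring
  have d4 : DD4 (twist t v) = t ^ 4 * DD4 v := by
    simp only [twist, DD4, Matrix.cons_val]
    ring_nf
    simp only [hr]
    ring
  have d5 : DD5 (twist t v) = t ^ 5 * DD5 v := by
    simp only [twist, DD5, Matrix.cons_val]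
    ring_nf
    simp only [hr]
  have d6 : DD6 (twist t v) = t ^ 6 * DD6 v := by
    simp only [twist, DD6, Matrix.cons_val]
    ring_nf
    simp only [hr]
    ring
  have d7 : DD7 (twist t v) = t ^ 7 * DD7 v := by
    simp only [twist, DD7, Matrix.cons_val]
    ring_nf
    simp only [hr]
    ring
  have d8 : DD8 (twist t v) = t ^ 8 * DD8 v := by
    simp only [twist, DD8, Matrix.cons_val]
    ring_nf
    simp only [hr]
  have d9 : DD9 (twist t v) = t ^ 9 * DD9 v := by
    simp only [twist, DD9, Matrix.cons_val]
    ring_nf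
    simp only [hr]
    ring
  have d10 : DD10 (twist t v) = t ^ 10 * DD10 v := by
    simp only [twist, DD10, Matrix.cons_val]
    ring_nf
    simp only [hr]
    ring
  have d11 : DD11 (twist t v) = t ^ 11 * DD11 v := by
    simp only [twist, DD11, Matrix.cons_val]
    ring_nf
    simp only [hr]
    ring
  have d12 : DD12 (twist t v) = t ^ 12 * DD12 v := by
    simp only [twist, DD12, Matrix.cons_val]
    ring_nf
    simp only [hr]
    ring
  have g0 : GG0 (twist t v) = GG0 v := by rw [GG0, GG0, d0, dinf]
  have g1 : GG1 (twist t v) = t ^ 1 * GG1 v := by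
    simp only [GG1, d0, d1, d2, d3, d4, d5, d6, d7, d8, d9, d10, d11, d12, dinf]
    ring_nf
    simp only [hr]
    ring
  have g2 : GG2 (twist t v) = t ^ 2 * GG2 v := by
    simp only [GG2, d0, d1, d2, d3, d4, d5, d6, d7, d8, d9, d10, d11, d12, dinf]
    ring_nf
    simp only [hr]
  have g3 : GG3 (twist t v) = t ^ 3 * GG3 v := by
    simp only [GG3, d0, d1, d2, d3, d4, d5, d6, d7, d8, d9, d10, d11, d12, dinf]
    ring_nf
    simp only [hr]
    ring
  have g4 : GG4 (twist t v) = t ^ 4 * GG4 v := by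
    simp only [GG4, d0, d1, d2, d3, d4, d5, d6, d7, d8, d9, d10, d11, d12, dinf]
    ring_nf
    simp only [hr]
    ring
  have g5 : GG5 (twist t v) = t ^ 5 * GG5 v := by
    simp only [GG5, d0, d1, d2, d3, d4, d5, d6, d7, d8, d9, d10, d11, d12, dinf]
    ring_nf
    simp only [hr]
    ring
  have g6 : GG6 (twist t v) = t ^ 6 * GG6 v := by
    simp only [GG6, d0, d1, d2, d3, d4, d5, d6, d7, d8, d9, d10, d11, d12, dinf]
    ring_nf
    simp only [hr]
    ring
  have g7 : GG7 (twist t v) = t ^ 7 * GG7 v := by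
    simp only [GG7, d0, d1, d2, d3, d4, d5, d6, d7, d8, d9, d10, d11, d12, dinf]
    ring_nf
    simp only [hr]
    ring
  have g8 : GG8 (twist t v) = t ^ 8 * GG8 v := by
    simp only [GG8, d0, d1, d2, d3, d4, d5, d6, d7, d8, d9, d10, d11, d12, dinf]
    ring_nf
    simp only [hr]
    ring
  have g9 : GG9 (twist t v) = t ^ 9 * GG9 v := by
    simp only [GG9, d0, d1, d2, d3, d4, d5, d6, d7, d8, d9, d10, d11, d12, dinf]
    ring_nf
    simp only [hr]
    ring
  have g10 : GG10 (twist t v) = t ^ 10 * GG10 v := by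
    simp only [GG10, d0, d1, d2, d3, d4, d5, d6, d7, d8, d9, d10, d11, d12, dinf]
    ring_nf
    simp only [hr]
  have g11 : GG11 (twist t v) = t ^ 11 * GG11 v := by
    simp only [GG11, d0, d1, d2, d3, d4, d5, d6, d7, d8, d9, d10, d11, d12, dinf]
    ring_nf
    simp only [hr]
    ring
  have g12 : GG12 (twist t v) = t ^ 12 * GG12 v := by
    simp only [GG12, d0, d1, d2, d3, d4, d5, d6, d7, d8, d9, d10, d11, d12, dinf]
    ring_nf
  simp only [dF, e, ← hζ, g0, g1, g2, g3, g4, g5, g6, g7, g8, g9, g10, g11, g12, mul_zero, pow_zero,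
    one_mul, pow_one]

theorem Phi12_eq_orbitForm (v : Fin 6 → ℂ) :
    orbitForm (oddVec v) = -(13 ^ 3 * 52) * Phi12 v := by
  have h (n : ℕ) : sexticForm (fourier13 (chirp (7 * n) (oddVec v))) = 13 * dF n v := by
    rw [chirp_oddVec, sexticForm_fourier13_oddVec, dF_twist]
  have h' : ∑ a, sexticForm (fourier13 (chirp a (oddVec v))) ^ 2 =
      ∑ n ∈ Finset.range 13, (13 * dF n v) ^ 2 := by
    rw [← Equiv.sum_comp (Equiv.mulLeft₀ (7 : ZMod 13) (by decide)), Finset.sum_range]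
    refine Fintype.sum_congr (α := Fin 13) _ _ fun a ↦ ?_
    rw [← h, Equiv.mulLeft₀_apply]
    congr 4
    exact congrArg (7 * ·) (ZMod.natCast_zmod_val (n := 13) a).symm
  have h0 : sexticForm (oddVec v) = GG0 v := by
    change (v 0 * v 1 * v 2) ^ 2 + (-v 4 * -v 5 * -v 3) ^ 2 = (v 0 * v 1 * v 2) ^ 2 +
      (v 3 * v 4 * v 5) ^ 2
    ring
  rw [orbitForm, h', h0, Phi12, dInf]
  simp only [mul_pow, ← Finset.mul_sum]
  ring

open Real in
/-- The theta series `∑ (-1) ^ n exp (π i (26 n + k) ^ 2 z / 52)`. -/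
def theta26 (k : ℤ) (z : ℂ) : ℂ :=
  ∑' n : ℤ, (-1) ^ n * cexp (π * I * (26 * n + k) ^ 2 * z / 52)

theorem theta26_neg (k : ℤ) (z : ℂ) : theta26 (-k) z = theta26 k z := by
  rw [theta26, ← Equiv.tsum_eq (Equiv.neg ℤ), theta26]
  refine tsum_congr fun n ↦ ?_
  simp only [Equiv.neg_apply, zpow_neg, ← inv_zpow, inv_neg, inv_one]
  congr 2
  push_cast
  ring

theorem theta26_add (k : ℤ) (z : ℂ) : theta26 (k + 26) z = -theta26 k z := by
  rw [theta26, theta26, ← Equiv.tsum_eq (Equiv.addRight (1 : ℤ)) fun n : ℤ ↦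
    (-1) ^ n * cexp (Real.pi * I * (26 * n + k) ^ 2 * z / 52), ← tsum_neg]
  refine tsum_congr fun n ↦ ?_
  rw [Equiv.coe_addRight, zpow_add_one₀ (by norm_num), mul_neg_one, neg_mul, neg_neg]
  congr 2
  push_cast
  ring

theorem th13_eq_theta26 (k : ℤ) (z : ℂ) : th13 (k ^ 2 / 104) k z = theta26 k z := by
  rw [th13, theta26, ← tsum_mul_left]
  refine tsum_congr fun n ↦ ?_
  rw [mul_left_comm, ← Complex.exp_add]
  congr 2
  push_cast
  ring

theorem theta26_thirteen (z : ℂ) : theta26 13 z = 0 := by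
  have h := theta26_add (-13) z
  rw [theta26_neg] at h
  norm_num at h
  linear_combination h / 2

/-- A summand of the theta series, grouped by residues modulo `13` in `thetaVec`. -/
def thetaTerm (z : ℂ) (m : ℤ) : ℂ := (-1) ^ m * cexp (Real.pi * I * (2 * m + 13) ^ 2 * z / 52)

def thetaVec (z : ℂ) (j : ZMod 13) : ℂ := ∑' n : ℤ, thetaTerm z (13 * n + j.val)

theorem thetaVec_eq_theta26 (z : ℂ) (j : ZMod 13) :
    thetaVec z j = (-1) ^ j.val * theta26 (2 * j.val + 13) z := by
  rw [thetaVec, theta26, ← tsum_mul_left]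
  refine tsum_congr fun n ↦ ?_
  have h : (-1 : ℂ) ^ (13 * n + j.val : ℤ) = (-1) ^ j.val * (-1) ^ n := by
    rw [zpow_add₀ (by norm_num), zpow_mul, zpow_natCast, mul_comm]
    norm_num
  rw [thetaTerm, h, mul_assoc]
  congr 3
  push_cast
  ring

theorem thetaVec_eq_oddVec (z : ℂ) : thetaVec z = oddVec (AV z) := by
  have a0 : AV z 0 = theta26 11 z := by rw [← th13_eq_theta26]; simp [AV, ta]; norm_num
  have a1 : AV z 1 = theta26 7 z := by rw [← th13_eq_theta26]; simp [AV, ta]; norm_num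
  have a2 : AV z 2 = theta26 5 z := by rw [← th13_eq_theta26]; simp [AV, ta]; norm_num
  have a3 : AV z 3 = -theta26 3 z := by rw [← th13_eq_theta26]; simp [AV, ta]; norm_num
  have a4 : AV z 4 = theta26 9 z := by rw [← th13_eq_theta26]; simp [AV, ta]; norm_num
  have a5 : AV z 5 = theta26 1 z := by rw [← th13_eq_theta26]; simp [AV, ta]
  have key (m : ℕ) (k : ℤ) (h : 2 * (m : ℤ) + 13 = k + 26) :
      (-1) ^ m * theta26 (2 * m + 13) z = (-1) ^ (m + 1) * theta26 k z := by
    rw [h, theta26_add]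
    ring
  have h (j : Fin 13) : thetaVec z j = (-1) ^ ((j : ℕ) + 1) * theta26 (2 * j - 13) z := by
    rw [← key _ _ (by ring)]
    exact thetaVec_eq_theta26 z j
  have h' (j : Fin 13) : thetaVec z j = (-1) ^ ((j : ℕ) + 1) * theta26 (13 - 2 * j) z := by
    rw [h, ← theta26_neg]
    congr 2
    ring
  ext j
  change Fin 13 at j
  fin_cases j
  · refine (h' 0).trans ?_
    norm_num [theta26_thirteen]
    rfl
  · refine (h' 1).trans (Eq.trans ?_ a0.symm)
    norm_num
  · refine (h' 2).trans (Eq.trans ?_ (congrArg Neg.neg a4).symm)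
    norm_num
  · refine (h' 3).trans (Eq.trans ?_ a1.symm)
    norm_num
  · refine (h' 4).trans (Eq.trans ?_ (congrArg Neg.neg a2).symm)
    norm_num
  · refine (h' 5).trans (Eq.trans ?_ (congrArg Neg.neg a3).symm)
    norm_num
  · refine (h' 6).trans (Eq.trans ?_ (congrArg Neg.neg a5).symm)
    norm_num
  · refine (h 7).trans (Eq.trans ?_ a5.symm)
    norm_num
  · refine (h 8).trans (Eq.trans ?_ a3.symm)
    norm_num
  · refine (h 9).trans (Eq.trans ?_ a2.symm)
    norm_num
  · refine (h 10).trans (Eq.trans ?_ (congrArg Neg.neg a1).symm)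
    norm_num
  · refine (h 11).trans (Eq.trans ?_ a4.symm)
    norm_num
  · refine (h 12).trans (Eq.trans ?_ (congrArg Neg.neg a0).symm)
    norm_num

theorem psi13_intCast (n : ℤ) : psi13 n = cexp (2 * Real.pi * I * n / 13) :=
  ZMod.stdAddChar_coe (N := 13) n

theorem thetaTerm_add_one (z : ℂ) (m : ℤ) :
    thetaTerm (z + 1) m = cexp (13 * Real.pi * I / 4) * (psi13 (7 * m ^ 2) * thetaTerm z m) := by
  obtain ⟨N, hN⟩ : ∃ N, m * (m + 13) = 2 * N := by
    obtain ⟨N, hN⟩ : Even (m * (m + 13)) := by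
      rcases Int.even_or_odd m with h | h
      · exact h.mul_right _
      · exact (h.add_odd (by decide)).mul_left _
    exact ⟨N, by rw [hN]; ring⟩
  have h : 7 * (m : ZMod 13) ^ 2 = N := by
    have := congrArg (Int.cast : ℤ → ZMod 13) hN
    have h13 : (13 : ZMod 13) = 0 := by decide
    push_cast at this
    linear_combination 7 * this - (7 * (m : ZMod 13) - N) * h13
  have hN' : (m : ℂ) * (m + 13) = 2 * N := mod_cast hN
  rw [h, psi13_intCast, thetaTerm, thetaTerm, mul_left_comm (cexp _) ((-1) ^ m),
    mul_left_comm _ ((-1) ^ m), ← exp_add, ← exp_add]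
  congr 2
  linear_combination Real.pi * I / 13 * hN'

theorem thetaVec_add_one (z : ℂ) :
    thetaVec (z + 1) = fun j ↦ cexp (13 * Real.pi * I / 4) * chirp 7 (thetaVec z) j := by
  ext j
  rw [chirp, thetaVec, thetaVec, ← tsum_mul_left, ← tsum_mul_left]
  refine tsum_congr fun n ↦ ?_
  rw [thetaTerm_add_one]
  have h13 : (13 : ZMod 13) = 0 := by decide
  simp [h13]

theorem thetaTerm_eq_jacobiTheta₂_term (z : ℂ) (m : ℤ) :
    thetaTerm z m = cexp (13 * Real.pi * I * z / 4) *
      jacobiTheta₂_term m (z / 2 + 1 / 2) (z / 13) := by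
  have h : (-1 : ℂ) ^ m = cexp (m * (Real.pi * I)) := by rw [exp_int_mul, exp_pi_mul_I]
  rw [thetaTerm, jacobiTheta₂_term, h, ← exp_add, ← exp_add]
  congr 1
  ring

theorem summable_thetaTerm {z : ℂ} (hz : 0 < z.im) : Summable (thetaTerm z) := by
  simp only [funext (thetaTerm_eq_jacobiTheta₂_term z)]
  refine ((summable_jacobiTheta₂_term_iff _ _).2 ?_).mul_left _
  simpa using hz

theorem fourier13_thetaVec {z : ℂ} (hz : 0 < z.im) (k : ZMod 13) :
    fourier13 (thetaVec z) k = ∑' m : ℤ, psi13 (k * m) * thetaTerm z m := by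
  have hs := summable_thetaTerm hz
  have hs' : Summable fun m : ℤ ↦ psi13 (k * m) * thetaTerm z m := by
    refine .of_norm ?_
    simpa [AddChar.norm_apply] using hs.norm
  obtain ⟨e, he⟩ : ∃ e : ZMod 13 × ℤ ≃ ℤ, ∀ j n, e (j, n) = 13 * n + j.val :=
    ⟨(Equiv.prodComm (Fin 13) ℤ).trans (Int.divModEquiv 13).symm, fun j n ↦
      congrArg (· + (j.val : ℤ)) (mul_comm n 13)⟩
  have hs'' : Summable fun p ↦ psi13 (k * (e p : ℤ)) * thetaTerm z (e p) := e.summable_iff.2 hs'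
  rw [← e.tsum_eq, hs''.tsum_prod, tsum_fintype, fourier13]
  refine Finset.sum_congr rfl fun j _ ↦ ?_
  have h13 : (13 : ZMod 13) = 0 := by decide
  rw [thetaVec, ← tsum_mul_left]
  refine tsum_congr fun n ↦ ?_
  rw [he]
  simp [h13]

theorem fourier13_thetaVec_eq {z : ℂ} (hz : 0 < z.im) (k : ZMod 13) :
    fourier13 (thetaVec z) k = -I * (1 / (-I * (z / 13)) ^ (1 / 2 : ℂ)) * thetaVec (-1 / z) k := by
  have hz0 : z ≠ 0 := by
    rintro rfl
    simp at hz
  have h1 : fourier13 (thetaVec z) k = cexp (13 * Real.pi * I * z / 4) *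
      jacobiTheta₂ (z / 2 + 1 / 2 + k.val / 13) (z / 13) := by
    rw [fourier13_thetaVec hz, jacobiTheta₂, ← tsum_mul_left]
    refine tsum_congr fun m ↦ ?_
    have : k * m = ((k.val * m : ℤ) : ZMod 13) := by simp
    rw [this, psi13_intCast, thetaTerm_eq_jacobiTheta₂_term, mul_left_comm]
    congr 1
    rw [jacobiTheta₂_term, jacobiTheta₂_term, ← exp_add]
    congr 1
    push_cast
    ring
  have hI : -I = cexp (-(13 * Real.pi * I / 2)) := by
    rw [show -(13 * Real.pi * I / 2) = -Real.pi / 2 * I + (-3 : ℤ) * (2 * Real.pi * I) by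
      push_cast; ring, exp_add, exp_int_mul_two_pi_mul_I, exp_neg_pi_div_two_mul_I, mul_one]
  have key (n : ℤ) : cexp (13 * Real.pi * I * z / 4) *
      (cexp (-Real.pi * I * (z / 2 + 1 / 2 + k.val / 13) ^ 2 / (z / 13)) *
        jacobiTheta₂_term (-n) ((z / 2 + 1 / 2 + k.val / 13) / (z / 13)) (-1 / (z / 13))) =
      -I * thetaTerm (-1 / z) (13 * n + k.val) := by
    have h (m : ℤ) : (-1 : ℂ) ^ m = cexp (m * (-Real.pi * I)) := by
      rw [exp_int_mul, neg_mul, exp_neg, exp_pi_mul_I, inv_neg, inv_one]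
    rw [hI, jacobiTheta₂_term, thetaTerm, h, ← exp_add, ← exp_add, ← exp_add, ← exp_add]
    congr 1
    push_cast
    field_simp
    ring
  calc fourier13 (thetaVec z) k = 1 / (-I * (z / 13)) ^ (1 / 2 : ℂ) *
        (cexp (13 * Real.pi * I * z / 4) *
          (cexp (-Real.pi * I * (z / 2 + 1 / 2 + k.val / 13) ^ 2 / (z / 13)) *
            jacobiTheta₂ ((z / 2 + 1 / 2 + k.val / 13) / (z / 13)) (-1 / (z / 13)))) := by
        rw [h1, jacobiTheta₂_functional_equation]
        ring
    _ = 1 / (-I * (z / 13)) ^ (1 / 2 : ℂ) * (-I * thetaVec (-1 / z) k) := by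
        congr 1
        rw [jacobiTheta₂, ← (Equiv.neg ℤ).tsum_eq, ← tsum_mul_left, ← tsum_mul_left, thetaVec,
          ← tsum_mul_left]
        exact tsum_congr key
    _ = _ := by ring

theorem Phi12_const_mul (c : ℂ) (v : Fin 6 → ℂ) : Phi12 (fun i ↦ c * v i) = c ^ 12 * Phi12 v := by
  have h := orbitForm_const_mul c (oddVec v)
  have h' : (fun j ↦ c * oddVec v j) = oddVec fun i ↦ c * v i := by
    ext j
    have h0 : c * 0 = 0 := mul_zero c
    have hn (x : ℂ) : c * -x = -(c * x) := mul_neg c x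
    fin_cases j
    exacts [h0, rfl, hn _, rfl, hn _, hn _, hn _, rfl, rfl, rfl, hn _, rfl, hn _]
  rw [h', Phi12_eq_orbitForm, Phi12_eq_orbitForm] at h
  linear_combination -h / (13 ^ 3 * 52)

theorem Phi12_AV_add_one (z : ℂ) : Phi12 (AV (z + 1)) = -Phi12 (AV z) := by
  have h := congrArg orbitForm (thetaVec_add_one z)
  rw [orbitForm_const_mul, orbitForm_chirp, thetaVec_eq_oddVec, thetaVec_eq_oddVec,
    Phi12_eq_orbitForm, Phi12_eq_orbitForm, ← exp_nat_mul,
    show ((12 : ℕ) : ℂ) * (13 * Real.pi * I / 4) = Real.pi * I + (19 : ℤ) * (2 * Real.pi * I) by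
      push_cast; ring, exp_add, exp_int_mul_two_pi_mul_I, exp_pi_mul_I] at h
  linear_combination -h / (13 ^ 3 * 52)

theorem Phi12_AV_neg_inv {z : ℂ} (hz : 0 < z.im) :
    Phi12 (AV (-1 / z)) = -z ^ 6 * Phi12 (AV z) := by
  have hz0 : z ≠ 0 := by
    rintro rfl
    simp at hz
  have h := congrArg orbitForm (funext (fourier13_thetaVec_eq hz))
  have hc : ((-I * (z / 13)) ^ (1 / 2 : ℂ)) ^ 12 = -(z ^ 6 / 13 ^ 6) := by
    rw [← cpow_nat_mul, show ((12 : ℕ) : ℂ) * (1 / 2) = (6 : ℕ) by norm_num, cpow_natCast, mul_pow,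
      neg_pow, show I ^ 6 = I ^ 4 * I ^ 2 by ring, I_pow_four, I_sq]
    ring
  have hI : I ^ 12 = 1 := by rw [show 12 = 4 * 3 by rfl, pow_mul, I_pow_four, one_pow]
  rw [orbitForm_const_mul, thetaVec_eq_oddVec, thetaVec_eq_oddVec,
    orbitForm_fourier13 (oddVec_neg _), Phi12_eq_orbitForm, Phi12_eq_orbitForm, mul_pow, div_pow,
    hc, neg_pow, hI] at h
  field_simp at h
  rw [neg_div]
  linear_combination -h

/-- Evaluation of the theta constants in terms of their leading powers of
`r = exp (2 π i z / 104)`. -/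
def scaleVec (r : ℂ) (u : Fin 6 → ℂ) : Fin 6 → ℂ :=
  ![r ^ 121 * u 0, r ^ 49 * u 1, r ^ 25 * u 2, r ^ 9 * u 3, r ^ 81 * u 4, r * u 5]

/-- The form `P` has leading term `c * r ^ e` along `scaleVec`, with corrections in powers of
`r ^ 104`. -/
def HasLead (P : (Fin 6 → ℂ) → ℂ) (e : ℕ) (c : ℂ) : Prop :=
  ∃ d : ℂ × (Fin 6 → ℂ) → ℂ, Continuous d ∧
    (∀ r u, P (scaleVec r u) = r ^ e * d (r ^ 104, u)) ∧ d (0, ![1, 1, 1, -1, 1, 1]) = c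

set_option maxRecDepth 20000 in
theorem Phi12_eq_sum (v : Fin 6 → ℂ) :
    Phi12 v = -(1 / 26) * (1183 * GG0 v ^ 2 + GG1 v * GG12 v + GG2 v * GG11 v + GG3 v * GG10 v +
      GG4 v * GG9 v + GG5 v * GG8 v + GG6 v * GG7 v) := by
  have h := zeta_geom_sum
  have hdF (n : ℕ) : dF n v = -13 * GG0 v + ζ ^ (n % 13) * GG1 v + ζ ^ (2 * n % 13) * GG2 v +
      ζ ^ (3 * n % 13) * GG3 v + ζ ^ (4 * n % 13) * GG4 v + ζ ^ (5 * n % 13) * GG5 v +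
      ζ ^ (6 * n % 13) * GG6 v + ζ ^ (7 * n % 13) * GG7 v + ζ ^ (8 * n % 13) * GG8 v +
      ζ ^ (9 * n % 13) * GG9 v + ζ ^ (10 * n % 13) * GG10 v + ζ ^ (11 * n % 13) * GG11 v +
      ζ ^ (12 * n % 13) * GG12 v := by
    simp only [dF, ← zeta_pow_mod]
  simp only [Phi12, dInf, hdF, Finset.sum_range_succ, Finset.sum_range_zero] at h ⊢
  generalize GG0 v = g0, GG1 v = g1, GG2 v = g2, GG3 v = g3, GG4 v = g4, GG5 v = g5, GG6 v = g6,
    GG7 v = g7, GG8 v = g8, GG9 v = g9, GG10 v = g10, GG11 v = g11, GG12 v = g12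
  norm_num
  ring_nf
  simp only [pow_reduce zeta_pow_thirteen]
  linear_combination (1 / 676) * ((-13 * g0 + g1 + g2 + g3 + g4 + g5 + g6 + g7 + g8 + g9 + g10 +
    g11 + g12) ^ 2 - ((-13 * g0) ^ 2 + 2 * (g1 * g12 + g2 * g11 + g3 * g10 + g4 * g9 + g5 * g8 +
    g6 * g7))) * h

theorem hasLead_DD0 : HasLead DD0 195 1 :=
  ⟨fun p ↦ p.2 0 * p.2 1 * p.2 2,
    by fun_prop,
    fun r u ↦ by simp only [DD0, scaleVec, Matrix.cons_val]; ring,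
    by simp only [Matrix.cons_val]; norm_num⟩

theorem hasLead_DD1 : HasLead DD1 99 2 :=
  ⟨fun p ↦ 2 * p.2 1 * p.2 2 ^ 2 + p.2 1 ^ 2 * p.2 5 - p.2 3 ^ 2 * p.2 4 +
      p.1 * p.2 0 * p.2 4 * p.2 5,
    by fun_prop,
    fun r u ↦ by simp only [DD1, scaleVec, Matrix.cons_val]; ring,
    by simp only [Matrix.cons_val]; norm_num⟩

theorem hasLead_DD2 : HasLead DD2 3 (-1) :=
  ⟨fun p ↦ -p.2 5 ^ 3 + p.1 * p.2 1 ^ 2 * p.2 3 - 2 * p.1 ^ 2 * p.2 1 * p.2 4 ^ 2 +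
      p.1 ^ 2 * p.2 0 * p.2 3 * p.2 4 + 3 * p.1 * p.2 2 * p.2 4 * p.2 5,
    by fun_prop,
    fun r u ↦ by simp only [DD2, scaleVec, Matrix.cons_val]; ring,
    by simp only [Matrix.cons_val]; norm_num⟩

theorem hasLead_DD3 : HasLead DD3 11 1 :=
  ⟨fun p ↦ 2 * p.1 ^ 2 * p.2 0 * p.2 1 ^ 2 + p.1 ^ 3 * p.2 0 ^ 2 * p.2 4 - p.2 3 * p.2 5 ^ 2 +
      p.1 * p.2 2 * p.2 3 * p.2 4,
    by fun_prop,
    fun r u ↦ by simp only [DD3, scaleVec, Matrix.cons_val]; ring,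
    by simp only [Matrix.cons_val]; norm_num⟩

theorem hasLead_DD4 : HasLead DD4 19 (-2) :=
  ⟨fun p ↦ -p.1 * p.2 1 ^ 2 * p.2 2 +
      p.1 * p.2 0 * p.2 5 ^ 2 - 2 * p.2 3 ^ 2 * p.2 5 - p.1 ^ 2 * p.2 0 * p.2 2 * p.2 4,
    by fun_prop,
    fun r u ↦ by simp only [DD4, scaleVec, Matrix.cons_val]; ring,
    by simp only [Matrix.cons_val]; norm_num⟩

theorem hasLead_DD5 : HasLead DD5 27 (-1) :=
  ⟨fun p ↦ -p.2 3 ^ 3 + p.1 * p.2 2 ^ 2 * p.2 4 - 2 * p.2 2 * p.2 5 ^ 2 +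
      p.1 * p.2 1 * p.2 4 * p.2 5 + 3 * p.1 * p.2 0 * p.2 3 * p.2 5,
    by fun_prop,
    fun r u ↦ by simp only [DD5, scaleVec, Matrix.cons_val]; ring,
    by simp only [Matrix.cons_val]; norm_num⟩

theorem hasLead_DD6 : HasLead DD6 35 (-1) :=
  ⟨fun p ↦ -p.1 ^ 2 * p.2 4 ^ 3 + p.1 ^ 2 * p.2 0 ^ 2 * p.2 5 - 2 * p.1 * p.2 0 * p.2 3 ^ 2 +
      p.2 2 * p.2 3 * p.2 5 + 3 * p.1 * p.2 1 * p.2 3 * p.2 4,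
    by fun_prop,
    fun r u ↦ by simp only [DD6, scaleVec, Matrix.cons_val]; ring,
    by simp only [Matrix.cons_val]; norm_num⟩

theorem hasLead_DD7 : HasLead DD7 43 1 :=
  ⟨fun p ↦ -p.1 * p.2 1 ^ 3 +
      p.2 2 * p.2 3 ^ 2 - p.1 * p.2 0 * p.2 2 * p.2 5 - 3 * p.1 ^ 2 * p.2 0 * p.2 1 * p.2 4 +
      2 * p.1 ^ 2 * p.2 0 ^ 2 * p.2 3,
    by fun_prop,
    fun r u ↦ by simp only [DD7, scaleVec, Matrix.cons_val]; ring,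
    by simp only [Matrix.cons_val]; norm_num⟩

theorem hasLead_DD8 : HasLead DD8 51 3 :=
  ⟨fun p ↦ -p.1 ^ 3 * p.2 0 ^ 3 +
      p.2 1 * p.2 5 ^ 2 - p.1 * p.2 1 * p.2 2 * p.2 4 - 3 * p.1 * p.2 0 * p.2 2 * p.2 3 +
      2 * p.2 2 ^ 2 * p.2 5,
    by fun_prop,
    fun r u ↦ by simp only [DD8, scaleVec, Matrix.cons_val]; ring,
    by simp only [Matrix.cons_val]; norm_num⟩

theorem hasLead_DD9 : HasLead DD9 59 (-2) :=
  ⟨fun p ↦ 2 * p.1 ^ 2 * p.2 0 ^ 2 * p.2 2 + p.2 2 ^ 2 * p.2 3 - p.1 * p.2 4 ^ 2 * p.2 5 +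
      p.2 1 * p.2 3 * p.2 5,
    by fun_prop,
    fun r u ↦ by simp only [DD9, scaleVec, Matrix.cons_val]; ring,
    by simp only [Matrix.cons_val]; norm_num⟩

theorem hasLead_DD10 : HasLead DD10 67 1 :=
  ⟨fun p ↦ -p.1 * p.2 0 * p.2 2 ^ 2 +
      p.2 1 * p.2 3 ^ 2 - 2 * p.1 * p.2 3 * p.2 4 ^ 2 - p.1 * p.2 0 * p.2 1 * p.2 5,
    by fun_prop,
    fun r u ↦ by simp only [DD10, scaleVec, Matrix.cons_val]; ring,
    by simp only [Matrix.cons_val]; norm_num⟩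

theorem hasLead_DD11 : HasLead DD11 75 (-4) :=
  ⟨fun p ↦ -p.2 2 ^ 3 +
      p.1 ^ 2 * p.2 0 * p.2 4 ^ 2 - p.1 * p.2 0 * p.2 1 * p.2 3 - 3 * p.2 1 * p.2 2 * p.2 5 +
      2 * p.1 * p.2 1 ^ 2 * p.2 4,
    by fun_prop,
    fun r u ↦ by simp only [DD11, scaleVec, Matrix.cons_val]; ring,
    by simp only [Matrix.cons_val]; norm_num⟩

theorem hasLead_DD12 : HasLead DD12 83 (-1) :=
  ⟨fun p ↦ -p.1 ^ 2 * p.2 0 ^ 2 * p.2 1 +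
      p.1 * p.2 2 * p.2 4 ^ 2 - 2 * p.2 4 * p.2 5 ^ 2 - p.2 1 * p.2 2 * p.2 3,
    by fun_prop,
    fun r u ↦ by simp only [DD12, scaleVec, Matrix.cons_val]; ring,
    by simp only [Matrix.cons_val]; norm_num⟩

theorem hasLead_DDinf : HasLead DDinf 91 (-1) :=
  ⟨fun p ↦ p.2 3 * p.2 4 * p.2 5,
    by fun_prop,
    fun r u ↦ by simp only [DDinf, scaleVec, Matrix.cons_val]; ring,
    by simp only [Matrix.cons_val]; norm_num⟩

theorem hasLead_GG0 : HasLead GG0 182 1 := by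
  obtain ⟨d0, c0, h0, v0⟩ := hasLead_DD0
  obtain ⟨dinf, cinf, hinf, vinf⟩ := hasLead_DDinf
  refine ⟨fun p ↦ p.1 ^ 2 * d0 p ^ 2 + dinf p ^ 2, by fun_prop, fun r u ↦ ?_, ?_⟩
  · simp only [GG0, h0, hinf]
    ring
  · norm_num [v0, vinf]

theorem hasLead_GG1 : HasLead GG1 86 13 := by
  obtain ⟨d7, c7, h7, v7⟩ := hasLead_DD7
  obtain ⟨d0, c0, h0, v0⟩ := hasLead_DD0
  obtain ⟨d1, c1, h1, v1⟩ := hasLead_DD1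
  obtain ⟨dinf, cinf, hinf, vinf⟩ := hasLead_DDinf
  obtain ⟨d2, c2, h2, v2⟩ := hasLead_DD2
  obtain ⟨d12, c12, h12, v12⟩ := hasLead_DD12
  obtain ⟨d3, c3, h3, v3⟩ := hasLead_DD3
  obtain ⟨d11, c11, h11, v11⟩ := hasLead_DD11
  obtain ⟨d4, c4, h4, v4⟩ := hasLead_DD4
  obtain ⟨d10, c10, h10, v10⟩ := hasLead_DD10
  obtain ⟨d9, c9, h9, v9⟩ := hasLead_DD9
  obtain ⟨d5, c5, h5, v5⟩ := hasLead_DD5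
  refine ⟨fun p ↦ -d7 p ^ 2 + 2 * p.1 ^ 2 * d0 p * d1 p + 10 * p.1 * dinf p * d1 p +
      2 * d2 p * d12 p - 2 * d3 p * d11 p - 4 * d4 p * d10 p - 2 * d9 p * d5 p, by fun_prop,
      fun r u ↦ ?_, ?_⟩
  · simp only [GG1, h7, h0, h1, hinf, h2, h12, h3, h11, h4, h10, h9, h5]
    ring
  · norm_num [v7, v0, v1, vinf, v2, v12, v3, v11, v4, v10, v9, v5]

theorem hasLead_GG2 : HasLead GG2 94 (-22) := by
  obtain ⟨d1, c1, h1, v1⟩ := hasLead_DD1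
  obtain ⟨d0, c0, h0, v0⟩ := hasLead_DD0
  obtain ⟨d2, c2, h2, v2⟩ := hasLead_DD2
  obtain ⟨dinf, cinf, hinf, vinf⟩ := hasLead_DDinf
  obtain ⟨d4, c4, h4, v4⟩ := hasLead_DD4
  obtain ⟨d11, c11, h11, v11⟩ := hasLead_DD11
  obtain ⟨d5, c5, h5, v5⟩ := hasLead_DD5
  obtain ⟨d10, c10, h10, v10⟩ := hasLead_DD10
  obtain ⟨d6, c6, h6, v6⟩ := hasLead_DD6
  obtain ⟨d9, c9, h9, v9⟩ := hasLead_DD9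
  obtain ⟨d7, c7, h7, v7⟩ := hasLead_DD7
  obtain ⟨d8, c8, h8, v8⟩ := hasLead_DD8
  refine ⟨fun p ↦ -2 * p.1 * d1 p ^ 2 - 4 * p.1 * d0 p * d2 p +
      6 * dinf p * d2 p - 2 * d4 p * d11 p +
      2 * d5 p * d10 p - 2 * d6 p * d9 p - 2 * d7 p * d8 p, by fun_prop, fun r u ↦ ?_, ?_⟩
  · simp only [GG2, h1, h0, h2, hinf, h4, h11, h5, h10, h6, h9, h7, h8]
    ring
  · norm_num [v1, v0, v2, vinf, v4, v11, v5, v10, v6, v9, v7, v8]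

theorem hasLead_GG3 : HasLead GG3 102 (-21) := by
  obtain ⟨d8, c8, h8, v8⟩ := hasLead_DD8
  obtain ⟨d0, c0, h0, v0⟩ := hasLead_DD0
  obtain ⟨d3, c3, h3, v3⟩ := hasLead_DD3
  obtain ⟨dinf, cinf, hinf, vinf⟩ := hasLead_DDinf
  obtain ⟨d6, c6, h6, v6⟩ := hasLead_DD6
  obtain ⟨d10, c10, h10, v10⟩ := hasLead_DD10
  obtain ⟨d9, c9, h9, v9⟩ := hasLead_DD9
  obtain ⟨d7, c7, h7, v7⟩ := hasLead_DD7
  obtain ⟨d12, c12, h12, v12⟩ := hasLead_DD12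
  obtain ⟨d4, c4, h4, v4⟩ := hasLead_DD4
  obtain ⟨d1, c1, h1, v1⟩ := hasLead_DD1
  obtain ⟨d2, c2, h2, v2⟩ := hasLead_DD2
  refine ⟨fun p ↦ -d8 p ^ 2 + 2 * p.1 * d0 p * d3 p + 10 * dinf p * d3 p +
      2 * d6 p * d10 p - 2 * d9 p * d7 p - 4 * d12 p * d4 p - 2 * d1 p * d2 p, by fun_prop,
      fun r u ↦ ?_, ?_⟩
  · simp only [GG3, h8, h0, h3, hinf, h6, h10, h9, h7, h12, h4, h1, h2]
    ring
  · norm_num [v8, v0, v3, vinf, v6, v10, v9, v7, v12, v4, v1, v2]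

theorem hasLead_GG4 : HasLead GG4 6 (-1) := by
  obtain ⟨d2, c2, h2, v2⟩ := hasLead_DD2
  obtain ⟨d0, c0, h0, v0⟩ := hasLead_DD0
  obtain ⟨d4, c4, h4, v4⟩ := hasLead_DD4
  obtain ⟨dinf, cinf, hinf, vinf⟩ := hasLead_DDinf
  obtain ⟨d5, c5, h5, v5⟩ := hasLead_DD5
  obtain ⟨d12, c12, h12, v12⟩ := hasLead_DD12
  obtain ⟨d9, c9, h9, v9⟩ := hasLead_DD9
  obtain ⟨d8, c8, h8, v8⟩ := hasLead_DD8
  obtain ⟨d1, c1, h1, v1⟩ := hasLead_DD1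
  obtain ⟨d3, c3, h3, v3⟩ := hasLead_DD3
  obtain ⟨d10, c10, h10, v10⟩ := hasLead_DD10
  obtain ⟨d7, c7, h7, v7⟩ := hasLead_DD7
  refine ⟨fun p ↦ -d2 p ^ 2 + 10 * p.1 ^ 2 * d0 p * d4 p - 2 * p.1 * dinf p * d4 p +
      2 * p.1 * d5 p * d12 p - 2 * p.1 * d9 p * d8 p - 4 * p.1 * d1 p * d3 p - 2 * p.1 * d10 p * d7 p, by fun_prop, fun r u ↦ ?_, ?_⟩
  · simp only [GG4, h2, h0, h4, hinf, h5, h12, h9, h8, h1, h3, h10, h7]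
    ring
  · norm_num [v2, v0, v4, vinf, v5, v12, v9, v8, v1, v3, v10, v7]

theorem hasLead_GG5 : HasLead GG5 14 2 := by
  obtain ⟨d9, c9, h9, v9⟩ := hasLead_DD9
  obtain ⟨d0, c0, h0, v0⟩ := hasLead_DD0
  obtain ⟨d5, c5, h5, v5⟩ := hasLead_DD5
  obtain ⟨dinf, cinf, hinf, vinf⟩ := hasLead_DDinf
  obtain ⟨d10, c10, h10, v10⟩ := hasLead_DD10
  obtain ⟨d8, c8, h8, v8⟩ := hasLead_DD8
  obtain ⟨d6, c6, h6, v6⟩ := hasLead_DD6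
  obtain ⟨d12, c12, h12, v12⟩ := hasLead_DD12
  obtain ⟨d2, c2, h2, v2⟩ := hasLead_DD2
  obtain ⟨d3, c3, h3, v3⟩ := hasLead_DD3
  obtain ⟨d11, c11, h11, v11⟩ := hasLead_DD11
  obtain ⟨d7, c7, h7, v7⟩ := hasLead_DD7
  refine ⟨fun p ↦ -2 * p.1 * d9 p ^ 2 - 4 * p.1 ^ 2 * d0 p * d5 p +
      6 * p.1 * dinf p * d5 p - 2 * p.1 * d10 p * d8 p +
      2 * p.1 * d6 p * d12 p - 2 * d2 p * d3 p - 2 * p.1 * d11 p * d7 p, by fun_prop,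
      fun r u ↦ ?_, ?_⟩
  · simp only [GG5, h9, h0, h5, hinf, h10, h8, h6, h12, h2, h3, h11, h7]
    ring
  · norm_num [v9, v0, v5, vinf, v10, v8, v6, v12, v2, v3, v11, v7]

theorem hasLead_GG6 : HasLead GG6 22 2 := by
  obtain ⟨d3, c3, h3, v3⟩ := hasLead_DD3
  obtain ⟨d0, c0, h0, v0⟩ := hasLead_DD0
  obtain ⟨d6, c6, h6, v6⟩ := hasLead_DD6
  obtain ⟨dinf, cinf, hinf, vinf⟩ := hasLead_DDinf
  obtain ⟨d12, c12, h12, v12⟩ := hasLead_DD12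
  obtain ⟨d7, c7, h7, v7⟩ := hasLead_DD7
  obtain ⟨d2, c2, h2, v2⟩ := hasLead_DD2
  obtain ⟨d4, c4, h4, v4⟩ := hasLead_DD4
  obtain ⟨d5, c5, h5, v5⟩ := hasLead_DD5
  obtain ⟨d1, c1, h1, v1⟩ := hasLead_DD1
  obtain ⟨d8, c8, h8, v8⟩ := hasLead_DD8
  obtain ⟨d11, c11, h11, v11⟩ := hasLead_DD11
  refine ⟨fun p ↦ -2 * d3 p ^ 2 - 4 * p.1 ^ 2 * d0 p * d6 p +
      6 * p.1 * dinf p * d6 p - 2 * p.1 * d12 p * d7 p +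
      2 * d2 p * d4 p - 2 * p.1 * d5 p * d1 p - 2 * p.1 * d8 p * d11 p, by fun_prop,
      fun r u ↦ ?_, ?_⟩
  · simp only [GG6, h3, h0, h6, hinf, h12, h7, h2, h4, h5, h1, h8, h11]
    ring
  · norm_num [v3, v0, v6, vinf, v12, v7, v2, v4, v5, v1, v8, v11]

theorem hasLead_GG7 : HasLead GG7 30 (-2) := by
  obtain ⟨d10, c10, h10, v10⟩ := hasLead_DD10
  obtain ⟨d0, c0, h0, v0⟩ := hasLead_DD0
  obtain ⟨d7, c7, h7, v7⟩ := hasLead_DD7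
  obtain ⟨dinf, cinf, hinf, vinf⟩ := hasLead_DDinf
  obtain ⟨d1, c1, h1, v1⟩ := hasLead_DD1
  obtain ⟨d6, c6, h6, v6⟩ := hasLead_DD6
  obtain ⟨d2, c2, h2, v2⟩ := hasLead_DD2
  obtain ⟨d5, c5, h5, v5⟩ := hasLead_DD5
  obtain ⟨d8, c8, h8, v8⟩ := hasLead_DD8
  obtain ⟨d12, c12, h12, v12⟩ := hasLead_DD12
  obtain ⟨d9, c9, h9, v9⟩ := hasLead_DD9
  obtain ⟨d11, c11, h11, v11⟩ := hasLead_DD11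
  refine ⟨fun p ↦ -2 * p.1 * d10 p ^ 2 + 6 * p.1 ^ 2 * d0 p * d7 p +
      4 * p.1 * dinf p * d7 p - 2 * p.1 * d1 p * d6 p - 2 * d2 p * d5 p - 2 * p.1 * d8 p * d12 p - 2 * p.1 * d9 p * d11 p, by fun_prop, fun r u ↦ ?_, ?_⟩
  · simp only [GG7, h10, h0, h7, hinf, h1, h6, h2, h5, h8, h12, h9, h11]
    ring
  · norm_num [v10, v0, v7, vinf, v1, v6, v2, v5, v8, v12, v9, v11]

theorem hasLead_GG8 : HasLead GG8 38 (-8) := by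
  obtain ⟨d4, c4, h4, v4⟩ := hasLead_DD4
  obtain ⟨d0, c0, h0, v0⟩ := hasLead_DD0
  obtain ⟨d8, c8, h8, v8⟩ := hasLead_DD8
  obtain ⟨dinf, cinf, hinf, vinf⟩ := hasLead_DDinf
  obtain ⟨d3, c3, h3, v3⟩ := hasLead_DD3
  obtain ⟨d5, c5, h5, v5⟩ := hasLead_DD5
  obtain ⟨d6, c6, h6, v6⟩ := hasLead_DD6
  obtain ⟨d2, c2, h2, v2⟩ := hasLead_DD2
  obtain ⟨d11, c11, h11, v11⟩ := hasLead_DD11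
  obtain ⟨d10, c10, h10, v10⟩ := hasLead_DD10
  obtain ⟨d1, c1, h1, v1⟩ := hasLead_DD1
  obtain ⟨d7, c7, h7, v7⟩ := hasLead_DD7
  refine ⟨fun p ↦ -2 * d4 p ^ 2 + 6 * p.1 ^ 2 * d0 p * d8 p +
      4 * p.1 * dinf p * d8 p - 2 * d3 p * d5 p - 2 * d6 p * d2 p - 2 * p.1 * d11 p * d10 p - 2 * p.1 * d1 p * d7 p, by fun_prop, fun r u ↦ ?_, ?_⟩
  · simp only [GG8, h4, h0, h8, hinf, h3, h5, h6, h2, h11, h10, h1, h7]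
    ring
  · norm_num [v4, v0, v8, vinf, v3, v5, v6, v2, v11, v10, v1, v7]

theorem hasLead_GG9 : HasLead GG9 46 6 := by
  obtain ⟨d11, c11, h11, v11⟩ := hasLead_DD11
  obtain ⟨d0, c0, h0, v0⟩ := hasLead_DD0
  obtain ⟨d9, c9, h9, v9⟩ := hasLead_DD9
  obtain ⟨dinf, cinf, hinf, vinf⟩ := hasLead_DDinf
  obtain ⟨d5, c5, h5, v5⟩ := hasLead_DD5
  obtain ⟨d4, c4, h4, v4⟩ := hasLead_DD4
  obtain ⟨d1, c1, h1, v1⟩ := hasLead_DD1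
  obtain ⟨d8, c8, h8, v8⟩ := hasLead_DD8
  obtain ⟨d10, c10, h10, v10⟩ := hasLead_DD10
  obtain ⟨d12, c12, h12, v12⟩ := hasLead_DD12
  obtain ⟨d3, c3, h3, v3⟩ := hasLead_DD3
  obtain ⟨d6, c6, h6, v6⟩ := hasLead_DD6
  refine ⟨fun p ↦ -p.1 * d11 p ^ 2 + 2 * p.1 ^ 2 * d0 p * d9 p + 10 * p.1 * dinf p * d9 p +
      2 * d5 p * d4 p - 2 * p.1 * d1 p * d8 p - 4 * p.1 * d10 p * d12 p - 2 * d3 p * d6 p,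
      by fun_prop, fun r u ↦ ?_, ?_⟩
  · simp only [GG9, h11, h0, h9, hinf, h5, h4, h1, h8, h10, h12, h3, h6]
    ring
  · norm_num [v11, v0, v9, vinf, v5, v4, v1, v8, v10, v12, v3, v6]

theorem hasLead_GG10 : HasLead GG10 54 1 := by
  obtain ⟨d5, c5, h5, v5⟩ := hasLead_DD5
  obtain ⟨d0, c0, h0, v0⟩ := hasLead_DD0
  obtain ⟨d10, c10, h10, v10⟩ := hasLead_DD10
  obtain ⟨dinf, cinf, hinf, vinf⟩ := hasLead_DDinf
  obtain ⟨d6, c6, h6, v6⟩ := hasLead_DD6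
  obtain ⟨d4, c4, h4, v4⟩ := hasLead_DD4
  obtain ⟨d3, c3, h3, v3⟩ := hasLead_DD3
  obtain ⟨d7, c7, h7, v7⟩ := hasLead_DD7
  obtain ⟨d9, c9, h9, v9⟩ := hasLead_DD9
  obtain ⟨d1, c1, h1, v1⟩ := hasLead_DD1
  obtain ⟨d12, c12, h12, v12⟩ := hasLead_DD12
  obtain ⟨d11, c11, h11, v11⟩ := hasLead_DD11
  refine ⟨fun p ↦ -d5 p ^ 2 + 10 * p.1 ^ 2 * d0 p * d10 p - 2 * p.1 * dinf p * d10 p +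
      2 * d6 p * d4 p - 2 * d3 p * d7 p - 4 * p.1 * d9 p * d1 p - 2 * p.1 * d12 p * d11 p,
      by fun_prop, fun r u ↦ ?_, ?_⟩
  · simp only [GG10, h5, h0, h10, hinf, h6, h4, h3, h7, h9, h1, h12, h11]
    ring
  · norm_num [v5, v0, v10, vinf, v6, v4, v3, v7, v9, v1, v12, v11]

theorem hasLead_GG11 : HasLead GG11 62 (-8) := by
  obtain ⟨d12, c12, h12, v12⟩ := hasLead_DD12
  obtain ⟨d0, c0, h0, v0⟩ := hasLead_DD0
  obtain ⟨d11, c11, h11, v11⟩ := hasLead_DD11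
  obtain ⟨dinf, cinf, hinf, vinf⟩ := hasLead_DDinf
  obtain ⟨d9, c9, h9, v9⟩ := hasLead_DD9
  obtain ⟨d2, c2, h2, v2⟩ := hasLead_DD2
  obtain ⟨d5, c5, h5, v5⟩ := hasLead_DD5
  obtain ⟨d6, c6, h6, v6⟩ := hasLead_DD6
  obtain ⟨d7, c7, h7, v7⟩ := hasLead_DD7
  obtain ⟨d4, c4, h4, v4⟩ := hasLead_DD4
  obtain ⟨d3, c3, h3, v3⟩ := hasLead_DD3
  obtain ⟨d8, c8, h8, v8⟩ := hasLead_DD8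
  refine ⟨fun p ↦ -2 * p.1 * d12 p ^ 2 + 6 * p.1 ^ 2 * d0 p * d11 p +
      4 * p.1 * dinf p * d11 p - 2 * d9 p * d2 p - 2 * d5 p * d6 p - 2 * d7 p * d4 p - 2 * d3 p * d8 p, by fun_prop, fun r u ↦ ?_, ?_⟩
  · simp only [GG11, h12, h0, h11, hinf, h9, h2, h5, h6, h7, h4, h3, h8]
    ring
  · norm_num [v12, v0, v11, vinf, v9, v2, v5, v6, v7, v4, v3, v8]

theorem hasLead_GG12 : HasLead GG12 70 17 := by
  obtain ⟨d6, c6, h6, v6⟩ := hasLead_DD6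
  obtain ⟨d0, c0, h0, v0⟩ := hasLead_DD0
  obtain ⟨d12, c12, h12, v12⟩ := hasLead_DD12
  obtain ⟨dinf, cinf, hinf, vinf⟩ := hasLead_DDinf
  obtain ⟨d2, c2, h2, v2⟩ := hasLead_DD2
  obtain ⟨d10, c10, h10, v10⟩ := hasLead_DD10
  obtain ⟨d1, c1, h1, v1⟩ := hasLead_DD1
  obtain ⟨d11, c11, h11, v11⟩ := hasLead_DD11
  obtain ⟨d3, c3, h3, v3⟩ := hasLead_DD3
  obtain ⟨d9, c9, h9, v9⟩ := hasLead_DD9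
  obtain ⟨d4, c4, h4, v4⟩ := hasLead_DD4
  obtain ⟨d8, c8, h8, v8⟩ := hasLead_DD8
  refine ⟨fun p ↦ -d6 p ^ 2 + 10 * p.1 ^ 2 * d0 p * d12 p - 2 * p.1 * dinf p * d12 p +
      2 * d2 p * d10 p - 2 * p.1 * d1 p * d11 p - 4 * d3 p * d9 p - 2 * d4 p * d8 p,
      by fun_prop, fun r u ↦ ?_, ?_⟩
  · simp only [GG12, h6, h0, h12, hinf, h2, h10, h1, h11, h3, h9, h4, h8]
    ring
  · norm_num [v6, v0, v12, vinf, v2, v10, v1, v11, v3, v9, v4, v8]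

theorem hasLead_Phi12 : HasLead Phi12 52 1 := by
  obtain ⟨d0, c0, h0, v0⟩ := hasLead_GG0
  obtain ⟨d1, c1, h1, v1⟩ := hasLead_GG1
  obtain ⟨d2, c2, h2, v2⟩ := hasLead_GG2
  obtain ⟨d3, c3, h3, v3⟩ := hasLead_GG3
  obtain ⟨d4, c4, h4, v4⟩ := hasLead_GG4
  obtain ⟨d5, c5, h5, v5⟩ := hasLead_GG5
  obtain ⟨d6, c6, h6, v6⟩ := hasLead_GG6
  obtain ⟨d7, c7, h7, v7⟩ := hasLead_GG7
  obtain ⟨d8, c8, h8, v8⟩ := hasLead_GG8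
  obtain ⟨d9, c9, h9, v9⟩ := hasLead_GG9
  obtain ⟨d10, c10, h10, v10⟩ := hasLead_GG10
  obtain ⟨d11, c11, h11, v11⟩ := hasLead_GG11
  obtain ⟨d12, c12, h12, v12⟩ := hasLead_GG12
  refine ⟨fun p ↦ -(1 / 26) * (1183 * p.1 ^ 3 * d0 p ^ 2 + p.1 * d1 p * d12 p +
      p.1 * d2 p * d11 p + p.1 * d3 p * d10 p + d4 p * d9 p + d5 p * d8 p + d6 p * d7 p),
    by fun_prop, fun r u ↦ ?_, ?_⟩
  · rw [Phi12_eq_sum]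
    simp only [h0, h1, h2, h3, h4, h5, h6, h7, h8, h9, h10, h11, h12]
    ring
  · norm_num [v0, v1, v2, v3, v4, v5, v6, v7, v8, v9, v10, v11, v12]

section CuspForm

open Filter Topology
open UpperHalfPlane hiding I
open MatrixGroups ModularForm

theorem etaF_eq_eta : etaF = ModularForm.eta := by
  ext z
  simp only [etaF, ModularForm.eta, ModularForm.eta_q_eq_pow, Function.Periodic.qParam]
  norm_num

theorem etaF_add_one_pow (z : ℂ) : etaF (z + 1) ^ 12 = -etaF z ^ 12 := by
  have h : cexp (2 * Real.pi * I * (z + 1)) = cexp (2 * Real.pi * I * z) := by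
    rw [mul_add_one, exp_add, exp_two_pi_mul_I, mul_one]
  have h' : cexp (2 * Real.pi * I * (z + 1) / 24) ^ 12 =
      -cexp (2 * Real.pi * I * z / 24) ^ 12 := by
    rw [← exp_nat_mul, ← exp_nat_mul, ← neg_one_mul, ← exp_pi_mul_I, ← exp_add]
    congr 1
    push_cast
    ring
  rw [etaF, etaF, h, mul_pow, mul_pow, h', neg_mul]

theorem etaF_neg_inv_pow {z : ℂ} (hz : 0 < z.im) : etaF (-1 / z) ^ 12 = -z ^ 6 * etaF z ^ 12 := by
  have h := ModularForm.eta_comp_eq_csqrt_I_inv hz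
  simp only [Function.comp_apply, Pi.smul_apply, Pi.mul_apply, smul_eq_mul, ← etaF_eq_eta] at h
  have hs (w : ℂ) : Complex.sqrt w ^ 12 = w ^ 6 := by
    rw [Complex.sqrt, ← cpow_nat_mul, show ((12 : ℕ) : ℂ) * 2⁻¹ = (6 : ℕ) by norm_num,
      cpow_natCast]
  have hI : I ^ 6 = -1 := by rw [show I ^ 6 = I ^ 4 * I ^ 2 by ring, I_pow_four, I_sq, one_mul]
  rw [h, mul_pow, mul_pow, inv_pow, hs, hs, hI]
  norm_num

theorem theta26_eq_jacobiTheta₂ (k : ℤ) (z : ℂ) : theta26 k z =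
    cexp (Real.pi * I * k ^ 2 * z / 52) * jacobiTheta₂ (k * z / 2 + 1 / 2) (13 * z) := by
  rw [theta26, jacobiTheta₂, ← tsum_mul_left]
  refine tsum_congr fun n ↦ ?_
  have h : (-1 : ℂ) ^ n = cexp (n * (Real.pi * I)) := by rw [exp_int_mul, exp_pi_mul_I]
  rw [h, jacobiTheta₂_term, ← exp_add, ← exp_add]
  congr 1
  ring

theorem differentiableAt_theta26 (k : ℤ) {z : ℂ} (hz : 0 < z.im) :
    DifferentiableAt ℂ (theta26 k) z := by
  have h := (hasFDerivAt_jacobiTheta₂ (k * z / 2 + 1 / 2) (τ := 13 * z) (by simpa)).differentiableAt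
  have h' : DifferentiableAt ℂ (fun z : ℂ ↦ (k * z / 2 + 1 / 2, 13 * z)) z := by fun_prop
  rw [funext (theta26_eq_jacobiTheta₂ k)]
  exact (by fun_prop : DifferentiableAt ℂ (fun z : ℂ ↦ cexp (Real.pi * I * k ^ 2 * z / 52)) z).mul
    (DifferentiableAt.comp (g := fun p : ℂ × ℂ ↦ jacobiTheta₂ p.1 p.2) z h h')

theorem differentiableAt_Phi12_AV {z : ℂ} (hz : 0 < z.im) :
    DifferentiableAt ℂ (fun z ↦ Phi12 (AV z)) z := by
  have h : (fun z ↦ Phi12 (AV z)) = fun z ↦ -(1 / (13 ^ 3 * 52)) * orbitForm (thetaVec z) := by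
    ext z
    rw [thetaVec_eq_oddVec, Phi12_eq_orbitForm]
    ring
  have hd (j : ZMod 13) : DifferentiableAt ℂ (fun z ↦ thetaVec z j) z := by
    simp only [thetaVec_eq_theta26]
    exact (differentiableAt_theta26 _ hz).const_mul _
  rw [h]
  unfold orbitForm sexticForm fourier13 chirp
  fun_prop

theorem Phi12_xV (z : ℂ) : Phi12 (xV z) = etaF z ^ 12 * Phi12 (AV z) :=
  Phi12_const_mul (etaF z) (AV z)

theorem tendsto_tsum_exp {k : ℤ} (hk : ∀ n : ℤ, n ≠ 0 → 2 ≤ 13 * n ^ 2 + k * n) :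
    Tendsto (fun z : ℍ ↦ ∑' n : ℤ, (-1 : ℂ) ^ n *
      cexp (2 * Real.pi * I * (((13 * n ^ 2 + k * n : ℤ) : ℂ) / 2) * z)) atImInfty (𝓝 1) := by
  have hnorm (n : ℤ) (z : ℍ) : ‖(-1 : ℂ) ^ n *
      cexp (2 * Real.pi * I * (((13 * n ^ 2 + k * n : ℤ) : ℂ) / 2) * z)‖ =
      Real.exp (-(Real.pi * (13 * n ^ 2 + k * n : ℤ) * z.im)) := by
    rw [norm_mul, norm_zpow, norm_neg, norm_one, one_zpow, one_mul, norm_exp]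
    congr 1
    have : 2 * Real.pi * I * (((13 * n ^ 2 + k * n : ℤ) : ℂ) / 2) * z =
      ((Real.pi * (13 * n ^ 2 + k * n : ℤ) : ℝ) : ℂ) * (I * z) := by
      push_cast
      ring
    rw [this, re_ofReal_mul, I_mul_re]
    simp
  have hs : Summable fun n : ℤ ↦ Real.exp (-(Real.pi * (13 * n ^ 2 + k * n : ℤ))) := by
    have := ((summable_jacobiTheta₂_term_iff (k * I / 2) (13 * I)).2 (by simp)).norm
    simp only [norm_jacobiTheta₂_term] at this
    refine this.congr fun n ↦ ?_
    congr 1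
    simp
    ring
  have h0 (n : ℤ) (hn : n ≠ 0) : Tendsto (fun z : ℍ ↦ (-1 : ℂ) ^ n *
      cexp (2 * Real.pi * I * (((13 * n ^ 2 + k * n : ℤ) : ℂ) / 2) * z)) atImInfty (𝓝 0) := by
    rw [tendsto_zero_iff_norm_tendsto_zero]
    simp only [hnorm]
    have hpos : (0 : ℝ) < (13 * n ^ 2 + k * n : ℤ) := by
      have := hk n hn
      exact_mod_cast (by lia : 0 < 13 * n ^ 2 + k * n)
    exact Real.tendsto_exp_neg_atTop_nhds_zero.comp
      (tendsto_comap.const_mul_atTop (mul_pos Real.pi_pos hpos))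
  have := tendsto_tsum_of_dominated_convergence (𝓕 := atImInfty) (f := fun (z : ℍ) (n : ℤ) ↦
    (-1 : ℂ) ^ n * cexp (2 * Real.pi * I * (((13 * n ^ 2 + k * n : ℤ) : ℂ) / 2) * z))
    (g := fun n ↦ if n = 0 then 1 else 0) hs (fun n ↦ ?_) ?_
  · simpa only [tsum_ite_eq] using this
  · split_ifs with hn
    · simp [hn]
    · exact h0 n hn
  · filter_upwards [tendsto_comap.eventually_ge_atTop (1 : ℝ)] with z hz n
    rw [hnorm, Real.exp_le_exp, neg_le_neg_iff]
    refine le_mul_of_one_le_right (mul_nonneg Real.pi_pos.le ?_) hz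
    rcases eq_or_ne n 0 with rfl | hn
    · simp
    · have := hk n hn
      exact_mod_cast (by lia : 0 ≤ 13 * n ^ 2 + k * n)

theorem tendsto_eta_prod : Tendsto (fun z : ℍ ↦
    ∏' n : ℕ, (1 - cexp (2 * Real.pi * I * z) ^ (n + 1))) atImInfty (𝓝 1) := by
  have h := ((ModularForm.differentiableOn_tprod_one_sub_pow).differentiableAt
    (Metric.isOpen_ball.mem_nhds (Metric.mem_ball_self one_pos))).continuousAt.tendsto
  have h' := h.comp (UpperHalfPlane.qParam_tendsto_atImInfty zero_lt_one)
  simpa [Function.comp_def, Function.Periodic.qParam] using h'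

/-- The power series factors of the theta constants of order 13. -/
def unitVec (z : ℂ) : Fin 6 → ℂ :=
  let U (k : ℤ) := ∑' n : ℤ, (-1 : ℂ) ^ n *
    cexp (2 * Real.pi * I * (((13 * n ^ 2 + k * n : ℤ) : ℂ) / 2) * z)
  ![U 11, U 7, U 5, -U 3, U 9, U 1]

theorem AV_eq_scaleVec (z : ℂ) : AV z = scaleVec (cexp (2 * Real.pi * I * z / 104)) (unitVec z) := by
  have h (k : ℕ) (c : ℚ) (hc : c = k / 104) :
      cexp (2 * Real.pi * I * c * z) = cexp (2 * Real.pi * I * z / 104) ^ k := by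
    rw [← exp_nat_mul, hc]
    congr 1
    push_cast
    ring
  funext i
  fin_cases i
  · exact congrArg (· * _) (h 121 (121 / 104) (by norm_num))
  · exact congrArg (· * _) (h 49 (49 / 104) (by norm_num))
  · exact congrArg (· * _) (h 25 (25 / 104) (by norm_num))
  · exact (congrArg (-(· * _)) (h 9 (9 / 104) (by norm_num))).trans (mul_neg _ _).symm
  · exact congrArg (· * _) (h 81 (81 / 104) (by norm_num))
  · exact congrArg (· * _) ((h 1 (1 / 104) (by norm_num)).trans (pow_one _))

theorem tendsto_unitVec :
    Tendsto (fun z : ℍ ↦ unitVec z) atImInfty (𝓝 ![1, 1, 1, -1, 1, 1]) := by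
  have h {k : ℤ} (h0 : 0 ≤ k) (h1 : k ≤ 11) := tendsto_tsum_exp (k := k) fun n hn ↦ by
    rcases lt_or_gt_of_ne hn with hn | hn
    · nlinarith [mul_nonneg (sub_nonneg.2 h1) (by lia : 0 ≤ -n)]
    · nlinarith [mul_nonneg h0 hn.le]
  rw [tendsto_pi_nhds]
  intro i
  fin_cases i
  · exact h (k := 11) (by norm_num) (by norm_num)
  · exact h (k := 7) (by norm_num) (by norm_num)
  · exact h (k := 5) (by norm_num) (by norm_num)
  · exact (h (k := 3) (by norm_num) (by norm_num)).neg
  · exact h (k := 9) (by norm_num) (by norm_num)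
  · exact h (k := 1) (by norm_num) (by norm_num)

theorem tendsto_exp_two_pi_mul_I :
    Tendsto (fun z : ℍ ↦ cexp (2 * Real.pi * I * z)) atImInfty (𝓝 0) := by
  simpa [Function.Periodic.qParam] using UpperHalfPlane.qParam_tendsto_atImInfty zero_lt_one

theorem etaF_pow_twelve (z : ℂ) : etaF z ^ 12 = cexp (2 * Real.pi * I * z / 104) ^ 52 *
    (∏' n : ℕ, (1 - cexp (2 * Real.pi * I * z) ^ (n + 1))) ^ 12 := by
  rw [etaF, mul_pow, ← exp_nat_mul, ← exp_nat_mul]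
  congr 2
  push_cast
  ring

theorem exists_Phi12_AV_eq : ∃ d : ℍ → ℂ, Tendsto d atImInfty (𝓝 1) ∧
    ∀ z : ℍ, Phi12 (AV z) = cexp (2 * Real.pi * I * z / 104) ^ 52 * d z := by
  obtain ⟨d, hd, h, h1⟩ := hasLead_Phi12
  have hr (z : ℍ) : cexp (2 * Real.pi * I * z / 104) ^ 104 = cexp (2 * Real.pi * I * z) := by
    rw [← exp_nat_mul]
    congr 1
    push_cast
    ring
  refine ⟨fun z ↦ d (cexp (2 * Real.pi * I * z), unitVec z), ?_, fun z ↦ ?_⟩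
  · rw [← h1]
    exact (hd.tendsto _).comp (tendsto_exp_two_pi_mul_I.prodMk_nhds tendsto_unitVec)
  · rw [AV_eq_scaleVec, h, hr]

theorem exists_Phi12_xV_eq : ∃ d : ℍ → ℂ, Tendsto d atImInfty (𝓝 1) ∧
    ∀ z : ℍ, Phi12 (xV z) = cexp (2 * Real.pi * I * z) * d z := by
  obtain ⟨d, hd, h⟩ := exists_Phi12_AV_eq
  refine ⟨_, by simpa using (tendsto_eta_prod.pow 12).mul hd, fun z ↦ ?_⟩
  have hr : cexp (2 * Real.pi * I * z) = cexp (2 * Real.pi * I * z / 104) ^ 104 := by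
    rw [← exp_nat_mul]
    congr 1
    push_cast
    ring
  rw [Phi12_xV, h, etaF_pow_twelve, hr]
  ring

theorem Phi12_xV_slash_T :
    ((fun z : ℍ ↦ Phi12 (xV z)) ∣[(12 : ℤ)] ModularGroup.T) = fun z : ℍ ↦ Phi12 (xV z) := by
  ext z
  have hd : denom ModularGroup.T z = 1 := by
    rw [ModularGroup.denom_apply]
    simp [ModularGroup.T]
  rw [ModularForm.SL_slash_apply, hd, one_zpow, mul_one, modular_T_smul, coe_vadd, ofReal_one,
    add_comm, Phi12_xV, Phi12_xV, etaF_add_one_pow, Phi12_AV_add_one, neg_mul_neg]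

theorem Phi12_xV_slash_S :
    ((fun z : ℍ ↦ Phi12 (xV z)) ∣[(12 : ℤ)] ModularGroup.S) = fun z : ℍ ↦ Phi12 (xV z) := by
  ext z
  have hz := z.ne_zero
  rw [ModularForm.SL_slash_apply, ModularGroup.denom_S, UpperHalfPlane.modular_S_smul, coe_mk,
    inv_neg, ← one_div, ← neg_div, Phi12_xV, Phi12_xV, etaF_neg_inv_pow z.im_pos,
    Phi12_AV_neg_inv z.im_pos, zpow_neg, show (z : ℂ) ^ (12 : ℤ) = z ^ 12 from zpow_natCast _ 12]
  field_simp

theorem Phi12_xV_isZeroAtImInfty : IsZeroAtImInfty fun z : ℍ ↦ Phi12 (xV z) := by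
  obtain ⟨d, hd, h⟩ := exists_Phi12_xV_eq
  refine Tendsto.congr (fun z ↦ (h z).symm) ?_
  simpa using tendsto_exp_two_pi_mul_I.mul hd

/-- The form `Φ₁₂`, evaluated at the eta-multiplied theta constants, as a cusp form. -/
def cuspFormPhi12 : CuspForm 𝒮ℒ 12 where
  toFun z := Phi12 (xV z)
  slash_action_eq' A hA := by
    obtain ⟨A, rfl⟩ := hA
    exact SlashInvariantForm.slash_action_generators_SL2Z Phi12_xV_slash_S Phi12_xV_slash_T A
  holo' := by
    rw [UpperHalfPlane.mdifferentiable_iff]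
    refine .congr (f := fun z ↦ Phi12 (xV z)) (fun z hz ↦ ?_) fun z hz ↦ ?_
    · simp only [Phi12_xV, etaF_eq_eta]
      exact (((ModularForm.differentiableAt_eta_of_mem_upperHalfPlaneSet hz).pow 12).mul
        (differentiableAt_Phi12_AV hz)).differentiableWithinAt
    · simp [ofComplex_apply_of_im_pos hz]
  zero_at_cusps' hc := by
    rw [Subgroup.IsArithmetic.isCusp_iff_isCusp_SL2Z] at hc
    rw [OnePoint.isZeroAt_iff_forall_SL2Z hc]
    intro γ _
    rw [SlashInvariantForm.slash_action_generators_SL2Z Phi12_xV_slash_S Phi12_xV_slash_T]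
    exact Phi12_xV_isZeroAtImInfty

theorem Phi12_xV_eq_Δfun (z : ℍ) : Phi12 (xV z) = Δfun z := by
  obtain ⟨c, hc⟩ := CuspForm.exists_smul_discriminant_of_weight_eq_twelve cuspFormPhi12
  obtain ⟨d, hd, h⟩ := exists_Phi12_xV_eq
  have hF (w : ℍ) : Phi12 (xV w) = c * etaF w ^ 24 := by
    rw [etaF_eq_eta]
    exact (DFunLike.congr_fun hc w).symm
  have hd' (w : ℍ) : d w =
      c * (∏' n : ℕ, (1 - cexp (2 * Real.pi * I * w) ^ (n + 1))) ^ 24 := by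
    refine mul_left_cancel₀ (exp_ne_zero (2 * Real.pi * I * w)) ?_
    rw [← h, hF, etaF, mul_pow, ← exp_nat_mul]
    have : ((24 : ℕ) : ℂ) * (2 * Real.pi * I * w / 24) = 2 * Real.pi * I * w := by
      push_cast
      ring
    rw [this]
    ring
  have hlim := (tendsto_eta_prod.pow 24).const_mul c
  rw [one_pow, mul_one] at hlim
  have hc1 : c = 1 := tendsto_nhds_unique (hlim.congr fun w ↦ (hd' w).symm) hd
  simpa [hc1, Δfun] using hF z

end CuspForm

theorem stmt10 (z : ℂ) (hz : 0 < z.im) : Phi12 (xV z) = Δfun z :=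
  Phi12_xV_eq_Δfun ⟨z, hz⟩
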